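/- There exists B₀ > 0 and, for every p > 2, a constant C_p > 0 such that for all B ≥ B₀ and every vector field A of class C¹ on a neighborhood of the closure of Ω, one has λ₁(B·A) ≥ λ₁(B) − C_p·B^{3/2}·‖curl A − 1‖_{L^p(Ω)}. -/

import Mathlib

open MeasureTheory Filter Set Topology

noncomputable section

namespace SC

/-- The plane `ℝ²`. -/
abbrev Plane := ℝ × ℝ

/-- Squared Euclidean norm on the plane. -/
def esq (v : Plane) : ℝ := v.1 ^ 2 + v.2 ^ 2

/-- Euclidean dot product on the plane. -/
def dot2 (v w : Plane) : ℝ := v.1 * w.1 + v.2 * w.2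

/-- The reference vector potential `F₀(x) = (-x₂/2, x₁/2)`, with `curl F₀ = 1`. -/
def F0 : Plane → Plane := fun x => (-x.2 / 2, x.1 / 2)

/-- `u` is of class `Cⁿ` on a neighborhood of the closure of `Ω`. -/
def CNearCl {E : Type*} [NormedAddCommGroup E] [NormedSpace ℝ E]
    (n : ℕ) (Ω : Set Plane) (u : Plane → E) : Prop :=
  ∃ U : Set Plane, IsOpen U ∧ closure Ω ⊆ U ∧ ContDiffOn ℝ n u U

/-- The pointwise squared magnetic gradient `|(-i∇ - B·A)u|²`. -/
def magSq (B : ℝ) (A : Plane → Plane) (u : Plane → ℂ) (x : Plane) : ℝ :=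
  ‖(-Complex.I) * fderiv ℝ u x ((1 : ℝ), (0 : ℝ)) - ((B * (A x).1 : ℝ) : ℂ) * u x‖ ^ 2 +
  ‖(-Complex.I) * fderiv ℝ u x ((0 : ℝ), (1 : ℝ)) - ((B * (A x).2 : ℝ) : ℂ) * u x‖ ^ 2

/-- `curl A = ∂₁A₂ - ∂₂A₁`. -/
def curl2 (A : Plane → Plane) (x : Plane) : ℝ :=
  fderiv ℝ (fun y => (A y).2) x ((1 : ℝ), (0 : ℝ)) -
    fderiv ℝ (fun y => (A y).1) x ((0 : ℝ), (1 : ℝ))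

/-- The variational ground state energy `λ₁(B·A)` of the magnetic Neumann Laplacian. -/
def lam1A (Ω : Set Plane) (B : ℝ) (A : Plane → Plane) : ℝ :=
  sInf { r : ℝ | ∃ u : Plane → ℂ, CNearCl 1 Ω u ∧ (∫ x in Ω, ‖u x‖ ^ 2) ≠ 0 ∧
    r = (∫ x in Ω, magSq B A u x) / (∫ x in Ω, ‖u x‖ ^ 2) }

/-- `λ₁(B) = λ₁(B·F₀)`. -/
def lam1 (Ω : Set Plane) (B : ℝ) : ℝ := lam1A Ω B F0

/-- The Ginzburg–Landau energy functional. -/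
def GLenergy (Ω : Set Plane) (κ H : ℝ) (ψ : Plane → ℂ) (A : Plane → Plane) : ℝ :=
  ∫ x in Ω, (magSq (κ * H) A ψ x - κ ^ 2 * ‖ψ x‖ ^ 2 + κ ^ 2 / 2 * ‖ψ x‖ ^ 4
    + κ ^ 2 * H ^ 2 * (curl2 A x - 1) ^ 2)

/-- Admissible Ginzburg–Landau configurations. -/
def GLadm (Ω : Set Plane) (ψ : Plane → ℂ) (A : Plane → Plane) : Prop :=
  CNearCl 1 Ω ψ ∧ CNearCl 1 Ω A

/-- The normal state is a minimizer at `(κ, H)`. -/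
def NormalMin (Ω : Set Plane) (κ H : ℝ) : Prop :=
  ∀ ψ A, GLadm Ω ψ A → 0 ≤ GLenergy Ω κ H ψ A

/-- The normal state is the unique minimizer at `(κ, H)`. -/
def NormalUnique (Ω : Set Plane) (κ H : ℝ) : Prop :=
  NormalMin Ω κ H ∧
  ∀ ψ A, GLadm Ω ψ A → (∫ x in Ω, ‖ψ x‖ ^ 2) ≠ 0 → 0 < GLenergy Ω κ H ψ A

/-- `(ψ, A)` is a minimizer of the Ginzburg–Landau energy at `(κ, H)`. -/
def IsGLMin (Ω : Set Plane) (κ H : ℝ) (ψ : Plane → ℂ) (A : Plane → Plane) : Prop :=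
  GLadm Ω ψ A ∧ ∀ ψ' A', GLadm Ω ψ' A' → GLenergy Ω κ H ψ A ≤ GLenergy Ω κ H ψ' A'

/-- Lower global critical field. -/
def HC3low (Ω : Set Plane) (κ : ℝ) : ℝ := sInf {H : ℝ | 0 < H ∧ NormalMin Ω κ H}

/-- Upper global critical field. -/
def HC3up (Ω : Set Plane) (κ : ℝ) : ℝ :=
  sInf {H : ℝ | 0 < H ∧ ∀ H', H < H' → NormalUnique Ω κ H'}

/-- Lower local critical field. -/
def HlocLow (Ω : Set Plane) (κ : ℝ) : ℝ :=
  sInf {H : ℝ | 0 < H ∧ κ ^ 2 ≤ lam1 Ω (κ * H)}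

/-- Upper local critical field. -/
def HlocUp (Ω : Set Plane) (κ : ℝ) : ℝ :=
  sInf {H : ℝ | 0 < H ∧ ∀ H', H < H' → κ ^ 2 ≤ lam1 Ω (κ * H')}

/-- The inward unit normal `ν(s) = (-γ₂'(s), γ₁'(s))`. -/
def nuVec (γ : ℝ → Plane) (s : ℝ) : Plane := (-(deriv γ s).2, (deriv γ s).1)

/-- The curvature `k(s) = ⟨γ''(s), ν(s)⟩`. -/
def curvOf (γ : ℝ → Plane) (s : ℝ) : ℝ := dot2 (deriv (deriv γ) s) (nuVec γ s)

/-- The maximal curvature. -/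
def kmaxOf (γ : ℝ → Plane) : ℝ := sSup (Set.range (curvOf γ))

/-- A smooth counterclockwise arclength parametrization of the boundary of `Ω`. -/
structure BoundaryParam (Ω : Set Plane) where
  γ : ℝ → Plane
  L : ℝ
  L_pos : 0 < L
  smooth : ContDiff ℝ (⊤ : ℕ∞) γ
  periodic : Function.Periodic γ L
  unit_speed : ∀ s, esq (deriv γ s) = 1
  injOn : Set.InjOn γ (Set.Ico 0 L)
  range_eq : Set.range γ = frontier Ω
  inward : ∀ s, ∃ ε > 0, ∀ t ∈ Set.Ioo (0 : ℝ) ε, γ s + t • nuVec γ s ∈ Ω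

/-- The non-degeneracy assumption: finitely many points of maximal curvature,
all of them non-degenerate maxima. -/
def NonDegen {Ω : Set Plane} (P : BoundaryParam Ω) : Prop :=
  ∃ (N : ℕ) (s : Fin N → ℝ), 0 < N ∧ (∀ j, s j ∈ Set.Ico 0 P.L) ∧
    (∀ j, curvOf P.γ (s j) = kmaxOf P.γ) ∧
    (∀ t ∈ Set.Ico 0 P.L, (∀ j, t ≠ s j) → curvOf P.γ t < kmaxOf P.γ) ∧
    (∀ j, deriv (deriv (curvOf P.γ)) (s j) < 0)

/-- The ground state energy `μ(ζ)` of the de Gennes half-line model operator. -/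
def muGen (ζ : ℝ) : ℝ :=
  sInf { r : ℝ | ∃ φ : ℝ → ℝ, ContDiff ℝ 1 φ ∧ HasCompactSupport φ ∧
    (∃ τ, 0 < τ ∧ φ τ ≠ 0) ∧
    r = (∫ τ in Set.Ioi (0 : ℝ), ((deriv φ τ) ^ 2 + (τ + ζ) ^ 2 * (φ τ) ^ 2)) /
        (∫ τ in Set.Ioi (0 : ℝ), (φ τ) ^ 2) }

/-- The de Gennes constant `Θ₀`. -/
def Theta0 : ℝ := sInf (Set.range muGen)

/-- Standard facts about the de Gennes constant, taken as hypotheses. -/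
structure DeGennes where
  ξ₀ : ℝ
  u₀ : ℝ → ℝ
  theta_lb : 1 / 2 < Theta0
  theta_ub : Theta0 < 1
  ξ₀_mem : ξ₀ ∈ Set.Ioo (-1 : ℝ) 0
  ξ₀_min : muGen ξ₀ = Theta0
  ξ₀_uniq : ∀ ζ, muGen ζ = Theta0 → ζ = ξ₀
  ξ₀_sq : ξ₀ ^ 2 = Theta0
  u₀_pos : ∀ τ, 0 ≤ τ → 0 < u₀ τ
  u₀_smooth : ContDiffOn ℝ 2 u₀ (Set.Ici 0)
  u₀_sq_int : IntegrableOn (fun τ => (u₀ τ) ^ 2) (Set.Ioi 0)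
  u₀_normalized : (∫ τ in Set.Ioi (0 : ℝ), (u₀ τ) ^ 2) = 1
  u₀_neumann : derivWithin u₀ (Set.Ici 0) 0 = 0
  u₀_ode : ∀ τ ∈ Set.Ioi (0 : ℝ),
    -(deriv (deriv u₀) τ) + (τ + ξ₀) ^ 2 * u₀ τ = Theta0 * u₀ τ

/-- The universal constant `C₁ = u₀(0)²/3`. -/
def DeGennes.C1 (D : DeGennes) : ℝ := (D.u₀ 0) ^ 2 / 3

/-- Condition (★) on a vector field `A` at field strength `B` with constant `C₀`. -/
def StarCond (Ω : Set Plane) (C₀ B : ℝ) (A : Plane → Plane) : Prop :=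
  CNearCl 2 Ω A ∧
  (∀ x ∈ closure Ω, ‖A x‖ ≤ C₀) ∧
  (∀ x ∈ closure Ω, ‖fderiv ℝ A x‖ ≤ C₀) ∧
  (∀ x ∈ closure Ω, ‖fderiv ℝ (fderiv ℝ A) x‖ ≤ C₀) ∧
  (∀ x ∈ closure Ω, |curl2 A x - 1| ≤ C₀ * B ^ (-(1 : ℝ) / 4)) ∧
  (∀ x ∈ closure Ω, ‖fderiv ℝ (curl2 A) x‖ ≤ C₀ * B ^ (-(1 : ℝ) / 4)) ∧
  (∀ x ∈ frontier Ω, curl2 A x = 1)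

/-- The open unit disc. -/
def unitDisc : Set Plane := {x : Plane | x.1 ^ 2 + x.2 ^ 2 < 1}

/-- `Δ_B`: distance from `B/2 + ξ₀√B + δ₀` to the nearest integer. -/
def DeltaB (ξ₀ δ₀ B : ℝ) : ℝ :=
  sInf (Set.range (fun m : ℤ => |(m : ℝ) - B / 2 - ξ₀ * Real.sqrt B - δ₀|))

/-- Euclidean distance to the boundary of `Ω`. -/
def distBdry (Ω : Set Plane) (x : Plane) : ℝ :=
  sInf ((fun y => Real.sqrt (esq (x - y))) '' frontier Ω)

end SC

/-- Two primitives of the same form differ by a constant on a preconnected open set. -/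
lemma sub_const_of_hasFDerivAt {E : Type*} [NormedAddCommGroup E] [NormedSpace ℝ E]
    {h : E → E →L[ℝ] ℝ} {f g : E → ℝ} {s : Set E} (hs : IsOpen s) (hc : IsPreconnected s)
    (hf : ∀ x ∈ s, HasFDerivAt f (h x) x) (hg : ∀ x ∈ s, HasFDerivAt g (h x) x)
    {x y : E} (hx : x ∈ s) (hy : y ∈ s) : f x - g x = f y - g y := by
  have hd : ∀ z ∈ s, HasFDerivAt (fun z => f z - g z) (0 : E →L[ℝ] ℝ) z := fun z hz => by
    simpa using (hf z hz).fun_sub (hg z hz)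
  exact hs.is_const_of_fderiv_eq_zero (𝕜 := ℝ) (f := fun z => f z - g z) hc
    (fun z hz => (hd z hz).differentiableAt.differentiableWithinAt)
    (fun z hz => (hd z hz).fderiv) hx hy

/-- The real numbers with the discrete topology. -/
@[ext]
structure DiscreteReal where
  /-- The underlying real number. -/
  val : ℝ

instance : TopologicalSpace DiscreteReal := ⊥

instance : DiscreteTopology DiscreteReal := ⟨rfl⟩

/-- A locally exact form on a simply connected open set is exact. -/
lemma exists_primitive_of_simplyConnected {E : Type*} [NormedAddCommGroup E] [NormedSpace ℝ E]
    {Ω : Set E} (hΩ : IsOpen Ω) [SimplyConnectedSpace Ω] {h : E → E →L[ℝ] ℝ}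
    (hloc : ∀ x ∈ Ω, ∃ r > 0, ∃ ψ : E → ℝ, ∀ y ∈ Metric.ball x r, HasFDerivAt ψ (h y) y) :
    ∃ φ : E → ℝ, ∀ x ∈ Ω, HasFDerivAt φ (h x) x := by
  choose! r hr ψ hψ using hloc
  have key : ∀ (i j x y : E), i ∈ Ω → j ∈ Ω → x ∈ Metric.ball i (r i) ∩ Metric.ball j (r j) →
      y ∈ Metric.ball i (r i) ∩ Metric.ball j (r j) →
      ψ i x - ψ j x = ψ i y - ψ j y := fun i j x y hi hj hx hy =>
    sub_const_of_hasFDerivAt (Metric.isOpen_ball.inter Metric.isOpen_ball)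
      ((convex_ball _ _).inter (convex_ball _ _)).isPreconnected
      (fun z hz => hψ i hi z hz.1) (fun z hz => hψ j hj z hz.2) hx hy
  let Z : FiberBundleCore Ω Ω DiscreteReal :=
    { baseSet := fun i => {x | (x : E) ∈ Metric.ball (i : E) (r i)}
      isOpen_baseSet := fun i => Metric.isOpen_ball.preimage continuous_subtype_val
      indexAt := id
      mem_baseSet_at := fun x => Metric.mem_ball_self (hr x x.2)
      coordChange := fun i j x v => ⟨v.val + (ψ i x - ψ j x)⟩
      coordChange_self := fun i x _ v => by simp
      continuousOn_coordChange := fun i j => by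
        rintro ⟨x, v⟩ ⟨hx, -⟩
        have hev : (fun p : Ω × DiscreteReal =>
            (⟨p.2.val + (ψ i p.1 - ψ j p.1)⟩ : DiscreteReal)) =ᶠ[
              𝓝[({x : Ω | (x : E) ∈ Metric.ball (i : E) (r i)} ∩
                {x : Ω | (x : E) ∈ Metric.ball (j : E) (r j)}) ×ˢ univ] (x, v)]
            fun _ => ⟨v.val + (ψ i x - ψ j x)⟩ := by
          have h1 : ∀ᶠ p : Ω × DiscreteReal in 𝓝 (x, v), p.2 = v :=
            (continuous_snd.tendsto (x, v)).eventually
              (show ∀ᶠ w in 𝓝 v, w = v by simp [nhds_discrete])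
          filter_upwards [self_mem_nhdsWithin, nhdsWithin_le_nhds h1] with p hp hpv
          rw [hpv, key i j p.1 x i.2 j.2 hp.1 hx]
        exact (continuousWithinAt_const (b := (⟨v.val + (ψ i x - ψ j x)⟩ : DiscreteReal))
          ).congr_of_eventuallyEq hev rfl
      coordChange_comp := fun i j k x _ v => by
        ext
        change v.val + (ψ i x - ψ j x) + (ψ j x - ψ k x) = v.val + (ψ i x - ψ k x)
        ring }
  have hcov : IsCoveringMap (Bundle.TotalSpace.proj : Z.TotalSpace → Ω) :=
    FiberBundle.isCoveringMap (F := DiscreteReal) (E := Z.Fiber)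
  have : LocallyPathConnectedSpace Ω := hΩ.locallyPathConnectedSpace
  obtain ⟨a⟩ : Nonempty Ω := inferInstance
  obtain ⟨S, ⟨-, hS⟩, -⟩ := hcov.existsUnique_continuousMap_lifts (ContinuousMap.id Ω) a
    (⟨a, (⟨0⟩ : DiscreteReal)⟩ : Z.TotalSpace) rfl
  have hproj : ∀ x, (S x).proj = x := fun x => congrFun hS x
  let φ' : Ω → ℝ := fun x => DiscreteReal.val (S x).2 + ψ (S x).proj (S x).proj
  classical
  refine ⟨fun x => if hx : x ∈ Ω then φ' ⟨x, hx⟩ else 0, fun x hx => ?_⟩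
  have hcont : ContinuousAt (fun y => ((Z.localTriv ⟨x, hx⟩) (S y)).2) (⟨x, hx⟩ : Ω) := by
    have h1 : ContinuousAt (Z.localTriv ⟨x, hx⟩) (S ⟨x, hx⟩) := by
      apply (Z.localTriv ⟨x, hx⟩).continuousOn.continuousAt
      apply (Z.localTriv ⟨x, hx⟩).open_source.mem_nhds
      rw [FiberBundleCore.mem_localTriv_source]
      change ((S ⟨x, hx⟩).proj : E) ∈ Metric.ball x (r x)
      rw [hproj]
      exact Metric.mem_ball_self (hr x hx)
    exact continuous_snd.continuousAt.comp
      (h1.comp S.continuous.continuousAt)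
  set c : DiscreteReal := ((Z.localTriv ⟨x, hx⟩) (S ⟨x, hx⟩)).2 with hc
  have hev : ∀ᶠ y in 𝓝 (⟨x, hx⟩ : Ω), φ' y = c.val + ψ x y := by
    have : ∀ᶠ y in 𝓝 (⟨x, hx⟩ : Ω), ((Z.localTriv ⟨x, hx⟩) (S y)).2 = c :=
      hcont.eventually (show ∀ᶠ w : DiscreteReal in 𝓝 _, w = c by simp [nhds_discrete, hc])
    filter_upwards [this] with y hy
    rw [← hy]
    change _ = (DiscreteReal.val (S y).2 + (ψ (S y).proj (S y).proj - ψ x (S y).proj)) + _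
    rw [hproj y]
    simp only [φ', hproj y]
    ring
  have hev' : (fun x => if hx : x ∈ Ω then φ' ⟨x, hx⟩ else 0) =ᶠ[𝓝 x] fun y => c.val + ψ x y := by
    rw [nhds_subtype_eq_comap, eventually_comap] at hev
    filter_upwards [hev, hΩ.mem_nhds hx] with y hy hyΩ
    simp only [hyΩ, dif_pos]
    exact hy ⟨y, hyΩ⟩ rfl
  exact ((hψ x hx x (Metric.mem_ball_self (hr x hx))).const_add c.val).congr_of_eventuallyEq hev'

/-- A primitive on `Ω` extends to a neighborhood of `closure Ω` when the form is locally exact there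
and `Ω` is locally connected at its boundary. -/
lemma exists_primitive_nhds_closure {E : Type*} [NormedAddCommGroup E] [NormedSpace ℝ E]
    {Ω : Set E} (hΩ : IsOpen Ω) {h : E → E →L[ℝ] ℝ} {φ : E → ℝ}
    (hφ : ∀ x ∈ Ω, HasFDerivAt φ (h x) x)
    (hloc : ∀ x ∈ closure Ω, ∃ r > 0, ∃ ψ : E → ℝ, ∀ y ∈ Metric.ball x r, HasFDerivAt ψ (h y) y)
    (hconn : ∀ x ∈ frontier Ω, ∀ r > 0, ∃ δ > 0, ∃ S : Set E, S ⊆ Ω ∩ Metric.ball x r ∧ IsOpen S ∧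
      IsPreconnected S ∧ Metric.ball x δ ∩ Ω ⊆ S) :
    ∃ (U : Set E) (Φ : E → ℝ), IsOpen U ∧ closure Ω ⊆ U ∧ ∀ y ∈ U, HasFDerivAt Φ (h y) y := by
  have hbd : ∀ x ∈ frontier Ω, ∃ r > 0, ∃ ψ : E → ℝ,
      (∀ y ∈ Metric.ball x r, HasFDerivAt ψ (h y) y) ∧
      ∀ y ∈ Metric.ball x r ∩ Ω, ψ y = φ y := by
    intro x hx
    obtain ⟨r, hr, ψ, hψ⟩ := hloc x (frontier_subset_closure hx)
    obtain ⟨δ, hδ, S, hS, hSo, hSc, hsub⟩ := hconn x hx r hr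
    obtain ⟨y, hy, hyx⟩ := Metric.mem_closure_iff.1 (frontier_subset_closure hx) (min δ r)
      (lt_min hδ hr)
    have hyδ : y ∈ S := hsub ⟨by
      rw [Metric.mem_ball, dist_comm]; exact hyx.trans_le (min_le_left _ _), hy⟩
    refine ⟨min δ r, lt_min hδ hr, fun z => ψ z + (φ y - ψ y), fun z hz => ?_, fun z hz => ?_⟩
    · exact (hψ z (Metric.ball_subset_ball (min_le_right _ _) hz)).add_const _
    · have hzS : z ∈ S := hsub ⟨Metric.ball_subset_ball (min_le_left _ _) hz.1, hz.2⟩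
      have := sub_const_of_hasFDerivAt hSo hSc (fun w hw => hψ w (hS hw).2)
        (fun w hw => hφ w (hS hw).1) hzS hyδ
      dsimp only
      linarith
  choose! r hr ψ hψ hψφ using hbd
  have agree : ∀ x ∈ frontier Ω, ∀ y ∈ frontier Ω, r y ≤ r x → ∀ z,
      z ∈ Metric.ball x (r x / 3) → z ∈ Metric.ball y (r y / 3) → ψ x z = ψ y z := by
    intro x hx y hy hxy z hzx hzy
    have hrx := hr x hx
    have hry := hr y hy
    have hyx : y ∈ Metric.ball x (r x) := by
      rw [Metric.mem_ball] at *
      have := dist_triangle_left y x z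
      linarith
    obtain ⟨w, ⟨hwx, hwy⟩, hw⟩ : ((Metric.ball x (r x) ∩ Metric.ball y (r y)) ∩ Ω).Nonempty :=
      mem_closure_iff.1 (frontier_subset_closure hy) _
        (Metric.isOpen_ball.inter Metric.isOpen_ball) ⟨hyx, Metric.mem_ball_self hry⟩
    have := sub_const_of_hasFDerivAt (Metric.isOpen_ball.inter Metric.isOpen_ball)
      ((convex_ball x (r x)).inter (convex_ball y (r y))).isPreconnected
      (fun z hz => hψ x hx z hz.1) (fun z hz => hψ y hy z hz.2)
      (x := z) (y := w) ⟨Metric.ball_subset_ball (by linarith) hzx,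
        Metric.ball_subset_ball (by linarith) hzy⟩ ⟨hwx, hwy⟩
    rw [hψφ x hx w ⟨hwx, hw⟩, hψφ y hy w ⟨hwy, hw⟩] at this
    linarith
  have agree' : ∀ x ∈ frontier Ω, ∀ y ∈ frontier Ω, ∀ z,
      z ∈ Metric.ball x (r x / 3) → z ∈ Metric.ball y (r y / 3) → ψ x z = ψ y z := by
    intro x hx y hy z hzx hzy
    rcases le_total (r y) (r x) with hle | hle
    · exact agree x hx y hy hle z hzx hzy
    · exact (agree y hy x hx hle z hzy hzx).symm
  classical
  let Φ : E → ℝ := fun z => if z ∈ Ω then φ z else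
    if hz : ∃ x ∈ frontier Ω, z ∈ Metric.ball x (r x / 3) then ψ hz.choose z else 0
  have hΦ : ∀ x ∈ frontier Ω, ∀ z ∈ Metric.ball x (r x / 3), Φ z = ψ x z := by
    intro x hx z hz
    by_cases hzΩ : z ∈ Ω
    · simp only [Φ, if_pos hzΩ]
      exact (hψφ x hx z ⟨Metric.ball_subset_ball (by linarith [hr x hx]) hz, hzΩ⟩).symm
    · have hex : ∃ x ∈ frontier Ω, z ∈ Metric.ball x (r x / 3) := ⟨x, hx, hz⟩
      simp only [Φ, if_neg hzΩ, dif_pos hex]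
      exact agree' _ hex.choose_spec.1 x hx z hex.choose_spec.2 hz
  refine ⟨Ω ∪ ⋃ x ∈ frontier Ω, Metric.ball x (r x / 3), Φ,
    hΩ.union (isOpen_biUnion fun _ _ => Metric.isOpen_ball), fun x hx => ?_, fun y hy => ?_⟩
  · by_cases hxΩ : x ∈ Ω
    · exact Or.inl hxΩ
    · have hxf : x ∈ frontier Ω := by rw [hΩ.frontier_eq]; exact ⟨hx, hxΩ⟩
      exact Or.inr (mem_biUnion hxf (Metric.mem_ball_self (by linarith [hr x hxf])))
  · rcases hy with hy | hy
    · apply (hφ y hy).congr_of_eventuallyEq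
      filter_upwards [hΩ.mem_nhds hy] with z hz
      simp only [Φ, if_pos hz]
    · obtain ⟨x, hx, hyx⟩ := mem_iUnion₂.1 hy
      apply (hψ x hx y (Metric.ball_subset_ball (by linarith [hr x hx]) hyx)).congr_of_eventuallyEq
      filter_upwards [Metric.isOpen_ball.mem_nhds hyx] with z hz
      exact hΦ x hx z hz

namespace SC

/-- The normal chart `(s, t) ↦ γ(s) + t ν(s)` along a curve. -/
def normalChart (γ : ℝ → Plane) (p : ℝ × ℝ) : Plane := γ p.1 + p.2 • nuVec γ p.1

lemma contDiff_normalChart {γ : ℝ → Plane} (hγ : ContDiff ℝ (⊤ : ℕ∞) γ) :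
    ContDiff ℝ 1 (normalChart γ) := by
  have h1 : ContDiff ℝ 1 γ := hγ.of_le (by exact_mod_cast le_top)
  have h2 : ContDiff ℝ 1 (deriv γ) :=
    (contDiff_infty_iff_deriv.1 hγ).2.of_le (by exact_mod_cast le_top)
  unfold normalChart nuVec
  fun_prop

/-- The linear equivalence of the plane sending the standard basis to `v` and its rotation by a
quarter turn, for a unit vector `v`. -/
def rotEquiv (v : Plane) (hv : esq v = 1) : (ℝ × ℝ) ≃L[ℝ] Plane :=
  ContinuousLinearEquiv.equivOfInverse
    ((v.1 • ContinuousLinearMap.fst ℝ ℝ ℝ - v.2 • ContinuousLinearMap.snd ℝ ℝ ℝ).prod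
      (v.2 • ContinuousLinearMap.fst ℝ ℝ ℝ + v.1 • ContinuousLinearMap.snd ℝ ℝ ℝ))
    ((v.1 • ContinuousLinearMap.fst ℝ ℝ ℝ + v.2 • ContinuousLinearMap.snd ℝ ℝ ℝ).prod
      (-v.2 • ContinuousLinearMap.fst ℝ ℝ ℝ + v.1 • ContinuousLinearMap.snd ℝ ℝ ℝ))
    (by
      intro p
      simp only [esq] at hv
      ext
      · simp
        linear_combination p.1 * hv
      · simp
        linear_combination p.2 * hv)
    (by
      intro p
      simp only [esq] at hv
      ext
      · simp
        linear_combination p.1 * hv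
      · simp
        linear_combination p.2 * hv)

lemma hasStrictFDerivAt_normalChart {γ : ℝ → Plane} (hγ : ContDiff ℝ (⊤ : ℕ∞) γ) (s : ℝ)
    (hs : esq (deriv γ s) = 1) :
    HasStrictFDerivAt (normalChart γ) (rotEquiv (deriv γ s) hs : (ℝ × ℝ) →L[ℝ] Plane) (s, 0) := by
  have h1 : HasDerivAt γ (deriv γ s) s :=
    (hγ.differentiable (by simp) s).hasDerivAt
  have hν : ContDiff ℝ 1 (nuVec γ) := by
    have h2 : ContDiff ℝ 1 (deriv γ) :=
      (contDiff_infty_iff_deriv.1 hγ).2.of_le (by exact_mod_cast le_top)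
    unfold nuVec
    fun_prop
  have h2 : HasFDerivAt (fun p : ℝ × ℝ => γ p.1)
      ((ContinuousLinearMap.toSpanSingleton ℝ (deriv γ s)).comp
        (ContinuousLinearMap.fst ℝ ℝ ℝ)) (s, 0) :=
    HasFDerivAt.comp (g := γ) (s, (0 : ℝ)) h1.hasFDerivAt hasFDerivAt_fst
  have h3 : HasFDerivAt (fun p : ℝ × ℝ => nuVec γ p.1)
      ((fderiv ℝ (nuVec γ) s).comp (ContinuousLinearMap.fst ℝ ℝ ℝ)) (s, 0) :=
    HasFDerivAt.comp (g := nuVec γ) (s, (0 : ℝ))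
      ((hν.differentiable (by simp)) s).hasFDerivAt hasFDerivAt_fst
  have h4 := h2.add ((hasFDerivAt_snd (𝕜 := ℝ) (p := (s, (0 : ℝ)))).smul h3)
  refine ((contDiff_normalChart hγ).contDiffAt.hasStrictFDerivAt' ?_ (by simp))
  refine h4.congr_fderiv ?_
  ext <;> simp [rotEquiv, nuVec]

/-- Local picture of `Ω` near the boundary point `γ(s₀)`. -/
lemma BoundaryParam.exists_chart {Ω : Set Plane} (P : BoundaryParam Ω) (hΩ : IsOpen Ω)
    (s₀ : ℝ) {r : ℝ} (hr : 0 < r) :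
    ∃ (δ : ℝ) (S T : Set Plane), 0 < δ ∧ IsOpen S ∧ IsPreconnected S ∧ IsOpen T ∧
      S ⊆ Ω ∩ Metric.ball (P.γ s₀) r ∧ (T ⊆ Ω ∨ Disjoint T Ω) ∧
      S ∪ T ∪ frontier Ω ∈ 𝓝 (P.γ s₀) ∧
      ∀ s ∈ Ioo (s₀ - δ) (s₀ + δ), P.γ s ∈ closure T := by
  set F := normalChart P.γ with hF
  have hF0 : F (s₀, 0) = P.γ s₀ := by simp [hF, normalChart]
  have hFc : Continuous F := (contDiff_normalChart P.smooth).continuous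
  have hst := hasStrictFDerivAt_normalChart P.smooth s₀ (P.unit_speed s₀)
  set e := hst.toOpenPartialHomeomorph F with he
  have heF : ∀ x, e x = F x := fun x => rfl
  have hsrc : (s₀, (0 : ℝ)) ∈ e.source := hst.mem_toOpenPartialHomeomorph_source
  obtain ⟨δ₀, hδ₀, hball⟩ := Metric.isOpen_iff.1 e.open_source _ hsrc
  set δ₁ := min (δ₀ / 2) (P.L / 3) with hδ₁
  have hL := P.L_pos
  have hδ₁p : 0 < δ₁ := by positivity
  have hδ₁0 : δ₁ < δ₀ := (min_le_left _ _).trans_lt (by linarith)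
  have hδ₁L : δ₁ ≤ P.L / 3 := min_le_right _ _
  have hmem : ∀ s t, |s - s₀| < δ₀ → |t| < δ₀ → (s, t) ∈ e.source := fun s t h1 h2 => hball (by
    rw [Metric.mem_ball, Prod.dist_eq, Real.dist_eq, Real.dist_eq]
    simpa using ⟨h1, h2⟩)
  -- the rest of the boundary stays away from `γ(s₀)`
  have hK : IsCompact (P.γ '' Icc (s₀ + δ₁) (s₀ + P.L - δ₁)) :=
    isCompact_Icc.image P.smooth.continuous
  have hxK : P.γ s₀ ∉ P.γ '' Icc (s₀ + δ₁) (s₀ + P.L - δ₁) := by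
    rintro ⟨s, hs, hse⟩
    have hinj : Set.InjOn P.γ (Ico s₀ (s₀ + P.L)) := by
      intro a ha b hb hab
      obtain ⟨n, hn, -⟩ := existsUnique_add_zsmul_mem_Ico hL a 0
      obtain ⟨m, hm, -⟩ := existsUnique_add_zsmul_mem_Ico hL b 0
      have h1 := P.injOn (by simpa using hn) (by simpa using hm) (by
        rw [P.periodic.int_mul n a, P.periodic.int_mul m b, hab])
      have h2 : a - b = (m - n : ℤ) * P.L := by
        push_cast
        linarith
      have h3 : |a - b| < P.L := by
        rw [abs_lt]; constructor <;> linarith [ha.1, ha.2, hb.1, hb.2]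
      rw [h2, abs_mul, abs_of_pos hL] at h3
      have h4 : |((m - n : ℤ) : ℝ)| < 1 := by
        by_contra hcon
        nlinarith
      have h5 : m - n = 0 := by
        rw [← Int.abs_lt_one_iff]
        exact_mod_cast h4
      rw [h5] at h2
      simp at h2
      linarith
    have := hinj (x₁ := s) (x₂ := s₀) ⟨by linarith [hs.1], by linarith [hs.2]⟩
      ⟨le_rfl, by linarith⟩ hse
    linarith [hs.1]
  have hnhds : (P.γ '' Icc (s₀ + δ₁) (s₀ + P.L - δ₁))ᶜ ∩ Metric.ball (P.γ s₀) r ∈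
      𝓝 (F (s₀, 0)) := by
    rw [hF0]
    exact inter_mem (hK.isClosed.isOpen_compl.mem_nhds hxK) (Metric.ball_mem_nhds _ hr)
  obtain ⟨δ₂, hδ₂, hball₂⟩ := Metric.mem_nhds_iff.1 (hFc.continuousAt.preimage_mem_nhds hnhds)
  set δ := min δ₁ δ₂ with hδ
  have hδp : 0 < δ := lt_min hδ₁p hδ₂
  have hδ1 : δ ≤ δ₁ := min_le_left _ _
  have hδ2 : δ ≤ δ₂ := min_le_right _ _
  have hin : ∀ s t, |s - s₀| < δ → |t| < δ → F (s, t) ∉ P.γ '' Icc (s₀ + δ₁) (s₀ + P.L - δ₁) ∧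
      F (s, t) ∈ Metric.ball (P.γ s₀) r := fun s t h1 h2 => hball₂ (by
    rw [Metric.mem_ball, Prod.dist_eq, Real.dist_eq, Real.dist_eq]
    simpa using ⟨h1.trans_le hδ2, h2.trans_le hδ2⟩)
  have hfr : ∀ s t, |s - s₀| < δ → |t| < δ → F (s, t) ∈ frontier Ω → t = 0 := by
    intro s t hs ht hf
    rw [← P.range_eq] at hf
    obtain ⟨s', hs'⟩ := hf
    obtain ⟨n, hn, -⟩ := existsUnique_add_zsmul_mem_Ico hL s' (s₀ - δ₁)
    rw [← P.periodic.zsmul n s'] at hs'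
    generalize s' + n • P.L = σ at hs' hn
    have hK' := (hin s t hs ht).1
    have h1 : σ < s₀ + δ₁ := by
      by_contra hcon
      push Not at hcon
      exact hK' ⟨σ, ⟨hcon, by linarith [hn.2]⟩, hs'⟩
    have h2 : F (σ, 0) = F (s, t) := by rw [← hs']; simp [hF, normalChart]
    have h3 := e.injOn (hmem σ 0 (by rw [abs_lt]; constructor <;> linarith [hn.1])
      (by simpa using hδ₀))
      (hmem s t (by linarith) (by linarith)) (by rw [heF, heF, h2])
    exact (congrArg Prod.snd h3).symm
  have himg : ∀ I : Set ℝ, IsOpen I → (∀ t ∈ I, |t| < δ) →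
      IsOpen (F '' (Ioo (s₀ - δ) (s₀ + δ) ×ˢ I)) := fun I hI hIδ =>
    e.isOpen_image_of_subset_source (isOpen_Ioo.prod hI) (by
      rintro ⟨s, t⟩ ⟨hs, ht⟩
      refine hmem s t ?_ ((hIδ t ht).trans (by linarith))
      rw [abs_lt]; constructor <;> linarith [hs.1, hs.2])
  have hsabs : ∀ s ∈ Ioo (s₀ - δ) (s₀ + δ), |s - s₀| < δ := fun s hs => by
    rw [abs_lt]; constructor <;> linarith [hs.1, hs.2]
  have hdich : ∀ I : Set ℝ, Convex ℝ I → (∀ t ∈ I, |t| < δ ∧ t ≠ 0) →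
      F '' (Ioo (s₀ - δ) (s₀ + δ) ×ˢ I) ⊆ Ω ∨ Disjoint (F '' (Ioo (s₀ - δ) (s₀ + δ) ×ˢ I)) Ω := by
    intro I hI hIδ
    have hpre : IsPreconnected (F '' (Ioo (s₀ - δ) (s₀ + δ) ×ˢ I)) :=
      ((convex_Ioo _ _).prod hI).isPreconnected.image _ hFc.continuousOn
    rw [or_iff_not_imp_right, Set.not_disjoint_iff]
    rintro ⟨y, hy, hyΩ⟩
    apply hpre.subset_left_of_subset_union hΩ isClosed_closure.isOpen_compl
      (disjoint_compl_right_iff_subset.2 subset_closure) _ ⟨y, hy, hyΩ⟩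
    rintro _ ⟨⟨s, t⟩, ⟨hs, ht⟩, rfl⟩
    by_contra hcon
    simp only [mem_union, mem_compl_iff, not_or, not_not] at hcon
    refine (hIδ t ht).2 (hfr s t (hsabs s hs) (hIδ t ht).1 ?_)
    rw [hΩ.frontier_eq]
    exact ⟨hcon.2, hcon.1⟩
  refine ⟨δ, F '' (Ioo (s₀ - δ) (s₀ + δ) ×ˢ Ioo 0 δ), F '' (Ioo (s₀ - δ) (s₀ + δ) ×ˢ Ioo (-δ) 0),
    hδp, himg _ isOpen_Ioo ?_, ?_, himg _ isOpen_Ioo ?_, ?_, ?_, ?_, ?_⟩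
  · intro t ht; rw [abs_lt]; constructor <;> linarith [ht.1, ht.2]
  · exact ((convex_Ioo _ _).prod (convex_Ioo _ _)).isPreconnected.image _ hFc.continuousOn
  · intro t ht; rw [abs_lt]; constructor <;> linarith [ht.1, ht.2]
  · refine subset_inter ?_ ?_
    · refine (hdich (Ioo 0 δ) (convex_Ioo _ _) ?_).resolve_right ?_
      · intro t ht
        exact ⟨by rw [abs_lt]; constructor <;> linarith [ht.1, ht.2], ht.1.ne'⟩
      · rw [Set.not_disjoint_iff]
        obtain ⟨ε, hε, hεΩ⟩ := P.inward s₀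
        have hm : 0 < min ε δ := lt_min hε hδp
        refine ⟨F (s₀, min ε δ / 2), ⟨(s₀, min ε δ / 2), ⟨⟨by linarith, by linarith⟩,
          by positivity, by linarith [min_le_right ε δ]⟩, rfl⟩, ?_⟩
        exact hεΩ _ ⟨by positivity, by linarith [min_le_left ε δ]⟩
    · rintro _ ⟨⟨s, t⟩, ⟨hs, ht⟩, rfl⟩
      exact (hin s t (hsabs s hs) (by rw [abs_lt]; constructor <;> linarith [ht.1, ht.2])).2
  · apply hdich _ (convex_Ioo _ _)
    intro t ht
    exact ⟨by rw [abs_lt]; constructor <;> linarith [ht.1, ht.2], ht.2.ne⟩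
  · have h1 : F '' (Ioo (s₀ - δ) (s₀ + δ) ×ˢ Ioo (-δ) δ) ∈ 𝓝 (P.γ s₀) := by
      apply (himg _ isOpen_Ioo fun t ht => abs_lt.2 ht).mem_nhds
      exact ⟨(s₀, 0), ⟨⟨by linarith, by linarith⟩, by linarith, hδp⟩, hF0⟩
    filter_upwards [h1]
    rintro _ ⟨⟨s, t⟩, ⟨hs, ht⟩, rfl⟩
    rcases lt_trichotomy t 0 with h | h | h
    · exact Or.inl (Or.inr ⟨(s, t), ⟨hs, ht.1, h⟩, rfl⟩)
    · right
      rw [← P.range_eq]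
      exact ⟨s, by subst h; simp [hF, normalChart]⟩
    · exact Or.inl (Or.inl ⟨(s, t), ⟨hs, h, ht.2⟩, rfl⟩)
  · intro s hs
    have h1 : (s, (0 : ℝ)) ∈ closure (Ioo (s₀ - δ) (s₀ + δ) ×ˢ Ioo (-δ) 0) := by
      rw [closure_prod_eq]
      refine ⟨subset_closure hs, ?_⟩
      rw [closure_Ioo (by linarith)]
      exact ⟨by linarith, le_rfl⟩
    have h2 := image_closure_subset_closure_image hFc ⟨_, h1, rfl⟩
    simpa [hF, normalChart] using h2

/-- A bounded domain with smooth boundary lies on one side of its boundary; in particular it is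
locally connected at its boundary. -/
lemma BoundaryParam.locally_connected {Ω : Set Plane} (P : BoundaryParam Ω) (hΩ : IsOpen Ω)
    (hb : Bornology.IsBounded Ω) (x : Plane) (hx : x ∈ frontier Ω) (r : ℝ) (hr : 0 < r) :
    ∃ δ > 0, ∃ S : Set Plane, S ⊆ Ω ∩ Metric.ball x r ∧ IsOpen S ∧
      IsPreconnected S ∧ Metric.ball x δ ∩ Ω ⊆ S := by
  set D := {s : ℝ | P.γ s ∈ interior (closure Ω)} with hD
  have hfr : ∀ s, P.γ s ∈ frontier Ω := fun s => P.range_eq ▸ mem_range_self s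
  have hDT : ∀ s₀, ∃ δ > 0, ∃ S T : Set Plane, IsOpen S ∧ IsPreconnected S ∧
      S ⊆ Ω ∩ Metric.ball (P.γ s₀) r ∧ S ∪ T ∪ frontier Ω ∈ 𝓝 (P.γ s₀) ∧
      (s₀ ∈ D ∨ Disjoint T Ω) ∧ (Disjoint T Ω → ∀ s ∈ Ioo (s₀ - δ) (s₀ + δ), s ∉ D) := by
    intro s₀
    obtain ⟨δ, S, T, hδ, hS, hSc, hT, hSΩ, hTd, hn, hcl⟩ := P.exists_chart hΩ s₀ hr
    refine ⟨δ, hδ, S, T, hS, hSc, hSΩ, hn, ?_, ?_⟩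
    · refine hTd.imp_left fun hTΩ => ?_
      change P.γ s₀ ∈ interior (closure Ω)
      rw [mem_interior_iff_mem_nhds]
      refine mem_of_superset hn (union_subset (union_subset ?_ ?_) frontier_subset_closure)
      · exact fun y hy => subset_closure (hSΩ hy).1
      · exact hTΩ.trans subset_closure
    · intro hdis s hs hsD
      have h1 : Disjoint T (closure Ω) := hdis.closure_right hT
      obtain ⟨y, hy, hyT⟩ := mem_closure_iff.1 (hcl s hs) _ isOpen_interior hsD
      exact Set.disjoint_left.1 h1 hyT (interior_subset hy)
  have hDopen : IsOpen D := isOpen_interior.preimage P.smooth.continuous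
  have hDclosed : IsClosed D := by
    rw [← isOpen_compl_iff, isOpen_iff_mem_nhds]
    intro s hs
    obtain ⟨δ, hδ, S, T, -, -, -, -, h1, h2⟩ := hDT s
    filter_upwards [Ioo_mem_nhds (show s - δ < s by linarith) (show s < s + δ by linarith)]
      with σ hσ using h2 (h1.resolve_left hs) σ hσ
  have hDempty : D = ∅ := by
    refine (isClopen_iff.1 ⟨hDclosed, hDopen⟩).resolve_right fun hDu => ?_
    have hop : IsOpen (closure Ω) := by
      rw [← interior_eq_iff_isOpen]
      refine subset_antisymm interior_subset fun y hy => ?_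
      by_cases hyΩ : y ∈ Ω
      · exact interior_maximal subset_closure hΩ hyΩ
      · have : y ∈ range P.γ := by
          rw [P.range_eq, hΩ.frontier_eq]; exact ⟨hy, hyΩ⟩
        obtain ⟨s, rfl⟩ := this
        exact hDu.symm.subset (mem_univ s)
    rcases isClopen_iff.1 ⟨isClosed_closure, hop⟩ with h | h
    · exact (frontier_subset_closure.trans h.subset) hx
    · have h1 := hb.closure
      rw [h] at h1
      exact NormedSpace.unbounded_univ ℝ Plane h1
  obtain ⟨s₀, rfl⟩ : x ∈ range P.γ := P.range_eq ▸ hx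
  obtain ⟨δ, hδ, S, T, hS, hSc, hSΩ, hn, h1, -⟩ := hDT s₀
  have hT : Disjoint T Ω := h1.resolve_left (by rw [hDempty]; exact fun h => h)
  obtain ⟨ρ, hρ, hball⟩ := Metric.mem_nhds_iff.1 hn
  refine ⟨ρ, hρ, S, hSΩ, hS, hSc, fun y hy => ?_⟩
  rcases hball hy.1 with (h | h) | h
  · exact h
  · exact (Set.disjoint_left.1 hT h hy.2).elim
  · rw [hΩ.frontier_eq] at h
    exact (h.2 hy.2).elim

/-- The gradient `t / (2π|t|²)` of the Newtonian potential in the plane. -/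
def newtonGrad (t : Plane) : Plane := (2 * Real.pi * esq t)⁻¹ • t

/-- The Biot-Savart kernel of the plane, as a linear form. -/
def biotSavart (t : Plane) : Plane →L[ℝ] ℝ :=
  (newtonGrad t).1 • ContinuousLinearMap.snd ℝ ℝ ℝ -
    (newtonGrad t).2 • ContinuousLinearMap.fst ℝ ℝ ℝ

lemma biotSavart_apply (t v : Plane) :
    biotSavart t v = (newtonGrad t).1 * v.2 - (newtonGrad t).2 * v.1 := by
  simp [biotSavart]

@[fun_prop]
lemma continuous_esq : Continuous esq := by unfold esq; fun_prop

@[fun_prop]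
lemma measurable_newtonGrad : Measurable newtonGrad := by
  unfold newtonGrad
  have := continuous_esq.measurable
  fun_prop

lemma sq_norm_le_esq (t : Plane) : ‖t‖ ^ 2 ≤ esq t := by
  rw [esq, Prod.norm_def]
  rcases max_choice ‖t.1‖ ‖t.2‖ with h | h <;>
    rw [h, Real.norm_eq_abs, sq_abs] <;> nlinarith [sq_nonneg t.1, sq_nonneg t.2]

lemma norm_newtonGrad_le (t : Plane) : ‖newtonGrad t‖ ≤ ‖t‖⁻¹ := by
  rcases eq_or_ne t 0 with rfl | ht
  · simp [newtonGrad]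
  have h1 := norm_pos_iff.2 ht
  have h2 := sq_norm_le_esq t
  have h3 : 0 < esq t := lt_of_lt_of_le (by positivity) h2
  have hpi := Real.pi_gt_three
  rw [newtonGrad, norm_smul, Real.norm_eq_abs, abs_of_pos (by positivity), inv_mul_eq_div,
    div_le_iff₀ (by positivity), inv_mul_eq_div, le_div_iff₀ h1]
  nlinarith

lemma norm_biotSavart_le (t : Plane) : ‖biotSavart t‖ ≤ 2 * ‖t‖⁻¹ := by
  refine ContinuousLinearMap.opNorm_le_bound _ (by positivity) fun v => ?_
  rw [biotSavart_apply]
  have h := norm_newtonGrad_le t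
  have h1 := (norm_fst_le (newtonGrad t)).trans h
  have h2 := (norm_snd_le (newtonGrad t)).trans h
  have h3 := norm_fst_le v
  have h4 := norm_snd_le v
  calc ‖(newtonGrad t).1 * v.2 - (newtonGrad t).2 * v.1‖
      ≤ ‖(newtonGrad t).1‖ * ‖v.2‖ + ‖(newtonGrad t).2‖ * ‖v.1‖ := by
        rw [← norm_mul, ← norm_mul]; exact norm_sub_le _ _
    _ ≤ ‖t‖⁻¹ * ‖v‖ + ‖t‖⁻¹ * ‖v‖ := by gcongr
    _ = _ := by ring

lemma measurable_biotSavart : Measurable biotSavart := by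
  have h := measurable_newtonGrad
  unfold biotSavart
  exact (h.fst.smul_const _).sub (h.snd.smul_const _)

lemma integrableOn_norm_rpow_neg {q : ℝ} (hq : q < 2) (R : ℝ) :
    IntegrableOn (fun t : Plane => ‖t‖ ^ (-q)) (Metric.ball 0 R) := by
  rw [integrableOn_fun_norm_addHaar (volume : Measure Plane) (f := fun r : ℝ => r ^ (-q))]
  have hf : Module.finrank ℝ Plane - 1 = 1 := by simp
  rw [hf]
  rcases le_or_gt R 0 with h | h
  · simp [Ioo_eq_empty_of_le h]
  have h1 : IntegrableOn (fun r : ℝ => r ^ (1 - q)) (Ioo 0 R) := by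
    rw [intervalIntegral.integrableOn_Ioo_rpow_iff h]
    linarith
  refine h1.congr_fun (fun r hr => ?_) measurableSet_Ioo
  simp only [pow_one, smul_eq_mul]
  rw [sub_eq_add_neg, Real.rpow_add hr.1, Real.rpow_one]

lemma locallyIntegrable_newtonGrad : LocallyIntegrable newtonGrad := by
  rw [locallyIntegrable_iff]
  intro K hK
  obtain ⟨R, hR⟩ := hK.isBounded.subset_ball (0 : Plane)
  refine IntegrableOn.mono_set ?_ hR
  have h := integrableOn_norm_rpow_neg (q := 1) (by norm_num) R
  refine Integrable.mono' h measurable_newtonGrad.aestronglyMeasurable (ae_of_all _ fun t => ?_)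
  rw [Real.rpow_neg_one]
  exact norm_newtonGrad_le t

lemma locallyIntegrable_newtonGrad_fst : LocallyIntegrable (fun t => (newtonGrad t).1) :=
  fun x => (locallyIntegrable_newtonGrad x).imp fun _ h => ⟨h.1, h.2.fst⟩

lemma locallyIntegrable_newtonGrad_snd : LocallyIntegrable (fun t => (newtonGrad t).2) :=
  fun x => (locallyIntegrable_newtonGrad x).imp fun _ h => ⟨h.1, h.2.snd⟩

lemma newtonGrad_polar {r : ℝ} (hr : 0 < r) (θ : ℝ) :
    r • newtonGrad (polarCoord.symm (r, θ)) =
      (2 * Real.pi)⁻¹ • ((Real.cos θ, Real.sin θ) : Plane) := by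
  have h : esq (polarCoord.symm (r, θ)) = r ^ 2 := by
    simp only [esq, polarCoord_symm_apply]
    linear_combination r ^ 2 * Real.sin_sq_add_cos_sq θ
  rw [newtonGrad, h, polarCoord_symm_apply]
  ext <;> simp <;> field_simp

/-- `∫ ∇N(t) · ∇g(x - t) dt = g(x)` for the Newtonian potential `N`. -/
lemma integral_fderiv_newtonGrad {g : Plane → ℝ} (hg : ContDiff ℝ 1 g) (hc : HasCompactSupport g)
    (x : Plane) : ∫ t, fderiv ℝ g (x - t) (newtonGrad t) = g x := by
  set d : ℝ → Plane := fun θ => (Real.cos θ, Real.sin θ) with hd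
  have hdc : Continuous d := by fun_prop
  have hdn : ∀ θ, 1 / 2 ≤ ‖d θ‖ := fun θ => by
    have h1 : esq (d θ) = 1 := by simp [esq, hd]
    by_contra! hcon
    have h2 := (norm_fst_le (d θ)).trans_lt hcon
    have h3 := (norm_snd_le (d θ)).trans_lt hcon
    rw [Real.norm_eq_abs, abs_lt] at h2 h3
    rw [esq] at h1
    nlinarith
  set G : ℝ × ℝ → ℝ := fun p => (2 * Real.pi)⁻¹ * fderiv ℝ g (x - p.1 • d p.2) (d p.2) with hG
  have hGc : Continuous G := by
    have := hg.continuous_fderiv (by simp)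
    fun_prop
  obtain ⟨M, hM⟩ := hc.isCompact.isBounded.subset_closedBall (0 : Plane)
  set R := 2 * (|M| + ‖x‖) with hR
  have hfar : ∀ r θ, R < |r| → x - r • d θ ∉ tsupport g := by
    intro r θ hr hmem
    have h1 := hM hmem
    rw [mem_closedBall_zero_iff] at h1
    have h2 : ‖r • d θ‖ ≤ ‖x‖ + ‖x - r • d θ‖ := by
      rw [← norm_neg (x - r • d θ)]
      calc ‖r • d θ‖ = ‖x + -(x - r • d θ)‖ := by congr 1; abel
        _ ≤ _ := norm_add_le _ _
    rw [norm_smul, Real.norm_eq_abs] at h2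
    nlinarith [hdn θ, le_abs_self M, abs_nonneg r]
  have hGi : IntegrableOn G (Ioi (0 : ℝ) ×ˢ Ioo (-Real.pi) Real.pi) := by
    have h1 : IntegrableOn G (Icc (0 : ℝ) R ×ˢ Icc (-Real.pi) Real.pi) :=
      hGc.continuousOn.integrableOn_compact (isCompact_Icc.prod isCompact_Icc)
    refine h1.of_forall_sdiff_eq_zero (measurableSet_Ioi.prod measurableSet_Ioo) ?_
    rintro ⟨r, θ⟩ ⟨⟨hr, hθ⟩, hn⟩
    have hrR : R < |r| := by
      by_contra! hcon
      exact hn ⟨⟨le_of_lt hr, (le_abs_self r).trans hcon⟩, ⟨hθ.1.le, hθ.2.le⟩⟩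
    have : fderiv ℝ g (x - r • d θ) = 0 := by
      by_contra h0
      exact hfar r θ hrR (support_fderiv_subset ℝ h0)
    simp [hG, this]
  have hinner : ∀ θ, ∫ r in Ioi (0 : ℝ), G (r, θ) = (2 * Real.pi)⁻¹ * g x := by
    intro θ
    have h1 : ContDiff ℝ 1 (fun r : ℝ => g (x - r • d θ)) := by fun_prop
    have h2 : HasCompactSupport (fun r : ℝ => g (x - r • d θ)) := by
      refine HasCompactSupport.intro (isCompact_Icc (a := -R) (b := R)) fun r hr => ?_
      refine image_eq_zero_of_notMem_tsupport (hfar r θ ?_)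
      by_contra! hcon
      exact hr (abs_le.1 hcon)
    have h3 : ∀ r, deriv (fun r : ℝ => g (x - r • d θ)) r = -(fderiv ℝ g (x - r • d θ) (d θ)) := by
      intro r
      have h4 : HasDerivAt (fun r : ℝ => x - r • d θ) (-(d θ)) r := by
        simpa using ((hasDerivAt_id r).smul_const (d θ)).const_sub x
      have h5 := (hg.differentiable (by simp) (x - r • d θ)).hasFDerivAt.comp_hasDerivAt r h4
      rw [map_neg] at h5
      exact h5.deriv
    have h6 := h2.integral_Ioi_deriv_eq h1 0
    simp only [h3, zero_smul, sub_zero] at h6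
    rw [integral_neg, neg_inj] at h6
    simp only [hG]
    rw [integral_const_mul, h6]
  rw [← integral_comp_polarCoord_symm]
  have htar : polarCoord.target = Ioi (0 : ℝ) ×ˢ Ioo (-Real.pi) Real.pi := rfl
  have hcongr : ∫ p in polarCoord.target, p.1 • fderiv ℝ g (x - polarCoord.symm p)
      (newtonGrad (polarCoord.symm p)) = ∫ p in Ioi (0 : ℝ) ×ˢ Ioo (-Real.pi) Real.pi, G p := by
    rw [htar]
    refine setIntegral_congr_fun (measurableSet_Ioi.prod measurableSet_Ioo) ?_
    rintro ⟨r, θ⟩ ⟨hr, -⟩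
    have h1 : polarCoord.symm (r, θ) = r • d θ := by
      rw [polarCoord_symm_apply]; simp [hd]
    dsimp only
    rw [← map_smul, newtonGrad_polar hr, map_smul, h1, smul_eq_mul]
  rw [hcongr, Measure.volume_eq_prod, ← Measure.prod_restrict, integral_prod_symm]
  · simp only [hinner, integral_const, measureReal_restrict_apply_univ, Real.volume_real_Ioo_of_le
      (neg_le_self Real.pi_pos.le), smul_eq_mul]
    field_simp
    ring
  · rw [Measure.prod_restrict, ← Measure.volume_eq_prod]
    exact hGi
lemma clm_plane_apply (T : Plane →L[ℝ] ℝ) (v : Plane) :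
    T v = v.1 * T (1, 0) + v.2 * T (0, 1) := by
  have hv : v = v.1 • ((1 : ℝ), (0 : ℝ)) + v.2 • ((0 : ℝ), (1 : ℝ)) := by ext <;> simp
  calc T v = T (v.1 • ((1 : ℝ), (0 : ℝ)) + v.2 • ((0 : ℝ), (1 : ℝ))) := by rw [← hv]
    _ = _ := by rw [map_add, map_smul, map_smul, smul_eq_mul, smul_eq_mul]

lemma integrable_mul_comp_sub {k g : Plane → ℝ} (hk : LocallyIntegrable k) (hg : Continuous g)
    (hc : HasCompactSupport g) (x : Plane) : Integrable fun t => k t * g (x - t) :=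
  hc.convolutionExists_right (ContinuousLinearMap.mul ℝ ℝ) hk hg x

lemma integrable_mul_biotSavart {c : Plane → ℝ} (hc : Continuous c) (hs : HasCompactSupport c)
    (x : Plane) : Integrable fun y => c y • biotSavart (x - y) := by
  have h1 := integrable_mul_comp_sub locallyIntegrable_newtonGrad_fst hc hs x
  have h2 := integrable_mul_comp_sub locallyIntegrable_newtonGrad_snd hc hs x
  have h := ((h1.smul_const (ContinuousLinearMap.snd ℝ ℝ ℝ)).sub
    (h2.smul_const (ContinuousLinearMap.fst ℝ ℝ ℝ))).comp_sub_left x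
  refine h.congr (ae_of_all _ fun y => ?_)
  ext <;> simp [biotSavart, mul_comm]

/-- Helmholtz decomposition of a compactly supported field: a gradient plus the Biot-Savart
field of its curl. -/
lemma exists_helmholtz {w₁ w₂ : Plane → ℝ} (h₁ : ContDiff ℝ 1 w₁) (hs₁ : HasCompactSupport w₁)
    (h₂ : ContDiff ℝ 1 w₂) (hs₂ : HasCompactSupport w₂) :
    ∃ φ : Plane → ℝ, ContDiff ℝ 1 φ ∧ ∀ x v, fderiv ℝ φ x v = w₁ x * v.1 + w₂ x * v.2 -
      ∫ y, (fderiv ℝ w₂ y (1, 0) - fderiv ℝ w₁ y (0, 1)) * biotSavart (x - y) v := by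
  have hN₁ := locallyIntegrable_newtonGrad_fst
  have hN₂ := locallyIntegrable_newtonGrad_snd
  set L := ContinuousLinearMap.mul ℝ ℝ
  have hd : ∀ {w : Plane → ℝ}, ContDiff ℝ 1 w → ∀ v : Plane,
      Continuous fun y => fderiv ℝ w y v := fun hw v =>
    (hw.continuous_fderiv (by simp)).clm_apply continuous_const
  have hds : ∀ {w : Plane → ℝ}, HasCompactSupport w → ∀ v : Plane,
      HasCompactSupport fun y => fderiv ℝ w y v := fun hw v =>
    hw.fderiv_apply ℝ v
  refine ⟨fun x => convolution (fun t => (newtonGrad t).1) w₁ L volume x +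
    convolution (fun t => (newtonGrad t).2) w₂ L volume x,
    (hs₁.contDiff_convolution_right L hN₁ (n := 1) h₁).add
      (hs₂.contDiff_convolution_right L hN₂ (n := 1) h₂), fun x v => ?_⟩
  have hder := (hs₁.hasFDerivAt_convolution_right L hN₁ h₁ x).add
    (hs₂.hasFDerivAt_convolution_right L hN₂ h₂ x)
  have hder' := congrArg (fun T : Plane →L[ℝ] ℝ => T v) hder.fderiv
  refine hder'.trans ?_
  rw [add_apply, convolution_precompR_apply L hN₁ (hs₁.fderiv ℝ)
    (h₁.continuous_fderiv (by simp)), convolution_precompR_apply L hN₂ (hs₂.fderiv ℝ)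
    (h₂.continuous_fderiv (by simp))]
  rw [← integral_sub_left_eq_self _ volume x]
  simp only [sub_sub_cancel]
  have hw : ∀ {w : Plane → ℝ}, ContDiff ℝ 1 w → HasCompactSupport w →
      w x = ∫ t, ((newtonGrad t).1 * fderiv ℝ w (x - t) (1, 0) +
        (newtonGrad t).2 * fderiv ℝ w (x - t) (0, 1)) := by
    intro w hw hs
    rw [← integral_fderiv_newtonGrad hw hs x]
    refine integral_congr_ae (ae_of_all _ fun t => ?_)
    exact clm_plane_apply _ _
  have hi₁ : ∀ v : Plane, _ := fun v => integrable_mul_comp_sub hN₁ (hd h₁ v) (hds hs₁ v) x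
  have hi₂ : ∀ v : Plane, _ := fun v => integrable_mul_comp_sub hN₂ (hd h₁ v) (hds hs₁ v) x
  have hi₃ : ∀ v : Plane, _ := fun v => integrable_mul_comp_sub hN₁ (hd h₂ v) (hds hs₂ v) x
  have hi₄ : ∀ v : Plane, _ := fun v => integrable_mul_comp_sub hN₂ (hd h₂ v) (hds hs₂ v) x
  have hg₁ : Integrable fun t => ((newtonGrad t).1 * fderiv ℝ w₁ (x - t) (1, 0) +
      (newtonGrad t).2 * fderiv ℝ w₁ (x - t) (0, 1)) * v.1 := ((hi₁ _).add (hi₂ _)).mul_const _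
  have hg₂ : Integrable fun t => ((newtonGrad t).1 * fderiv ℝ w₂ (x - t) (1, 0) +
      (newtonGrad t).2 * fderiv ℝ w₂ (x - t) (0, 1)) * v.2 := ((hi₃ _).add (hi₄ _)).mul_const _
  rw [hw h₁ hs₁, hw h₂ hs₂, ← integral_mul_const, ← integral_mul_const, ← integral_add hg₁ hg₂,
    ← integral_sub]
  · simp only [convolution, L, ContinuousLinearMap.mul_apply']
    rw [← integral_add (hi₁ v) (hi₄ v)]
    refine integral_congr_ae (ae_of_all _ fun t => ?_)
    simp only [clm_plane_apply (fderiv ℝ _ _) v, biotSavart_apply]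
    ring
  · exact hg₁.add hg₂
  · have h := (((hi₃ (1, 0)).sub (hi₁ (0, 1))).mul_const v.2).sub
      (((hi₄ (1, 0)).sub (hi₂ (0, 1))).mul_const v.1)
    refine h.congr (ae_of_all _ fun t => ?_)
    simp only [biotSavart_apply, Pi.sub_apply]
    ring

/-- The identification of the plane with `ℂ`. -/
def toC : Plane →L[ℝ] ℂ :=
  (ContinuousLinearMap.fst ℝ ℝ ℝ).smulRight 1 + (ContinuousLinearMap.snd ℝ ℝ ℝ).smulRight Complex.I

lemma toC_re (v : Plane) : (toC v).re = v.1 := by simp [toC]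

lemma toC_im (v : Plane) : (toC v).im = v.2 := by simp [toC]

lemma normSq_toC (v : Plane) : Complex.normSq (toC v) = esq v := by
  rw [Complex.normSq_apply, toC_re, toC_im, esq]; ring

lemma norm_le_norm_toC (v : Plane) : ‖v‖ ≤ ‖toC v‖ := by
  have h := sq_norm_le_esq v
  rw [← normSq_toC, ← Complex.sq_norm] at h
  exact le_of_sq_le_sq h (norm_nonneg _)

lemma norm_toC_le (v : Plane) : ‖toC v‖ ≤ 2 * ‖v‖ := by
  have h := Complex.norm_le_abs_re_add_abs_im (toC v)
  rw [toC_re, toC_im] at h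
  have h1 := norm_fst_le v
  have h2 := norm_snd_le v
  rw [Real.norm_eq_abs] at h1 h2
  linarith

lemma hasFDerivAt_arg_toC {c : ℂ} (hc : c ≠ 0) {x y : Plane}
    (h : toC (x - y) / c ∈ Complex.slitPlane) :
    HasFDerivAt (fun x => (2 * Real.pi)⁻¹ * (toC (x - y) / c).arg) (biotSavart (x - y)) x := by
  have h1 : HasFDerivAt (fun x : Plane => toC (x - y) / c) (c⁻¹ • toC) x := by
    simp only [div_eq_inv_mul]
    exact ((toC.hasFDerivAt.comp x ((hasFDerivAt_id x).sub_const y)).const_mul c⁻¹)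
  have h2 := ((Complex.hasDerivAt_log h).hasFDerivAt.restrictScalars ℝ).comp x h1
  have h3 := (Complex.imCLM.hasFDerivAt.comp x h2).const_mul (2 * Real.pi)⁻¹
  have ht : toC (x - y) ≠ 0 := fun h0 => Complex.slitPlane_ne_zero h (by simp [h0])
  refine (h3.congr_fderiv (ContinuousLinearMap.ext fun v => ?_)).congr_of_eventuallyEq
    (Eventually.of_forall fun z => by simp [Complex.log_im])
  have h4 : (toC (x - y) / c)⁻¹ * (c⁻¹ * toC v) = toC v / toC (x - y) := by field_simp
  have h5 : (2 * Real.pi)⁻¹ * ((toC (x - y) / c)⁻¹ * (c⁻¹ * toC v)).im =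
      biotSavart (x - y) v := by
    rw [h4, Complex.div_im, normSq_toC, toC_re, toC_im, toC_re, toC_im, biotSavart_apply, newtonGrad,
      Prod.smul_fst, Prod.smul_snd, smul_eq_mul, smul_eq_mul, mul_inv]
    ring
  rw [← h5]
  simp [mul_comm]

lemma exists_primitive_far {f : Plane → ℝ} (hf : Integrable f) {K : Set Plane}
    (hK : MeasurableSet K) {x₀ : Plane} {ρ : ℝ} (hρ : 0 < ρ) (hx : ∀ y ∈ K, ρ ≤ ‖x₀ - y‖) :
    ∃ r > 0, ∃ ψ : Plane → ℝ, ∀ x ∈ Metric.ball x₀ r,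
      HasFDerivAt ψ (∫ y in K, f y • biotSavart (x - y)) x := by
  have hnear : ∀ x ∈ Metric.ball x₀ (ρ / 4), ∀ y ∈ K, toC (x - y) / toC (x₀ - y) ∈
      Complex.slitPlane ∧ toC (x₀ - y) ≠ 0 ∧ ρ / 2 ≤ ‖x - y‖ := by
    intro x hxx y hy
    have h1 := hx y hy
    have h2 := h1.trans (norm_le_norm_toC _)
    rw [mem_ball_iff_norm] at hxx
    have h0 : toC (x₀ - y) ≠ 0 := norm_pos_iff.1 (hρ.trans_le h2)
    have h3 : toC (x - y) / toC (x₀ - y) = 1 + toC (x - x₀) / toC (x₀ - y) := by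
      field_simp
      rw [← map_add]
      congr 1; abel
    refine ⟨?_, h0, ?_⟩
    · rw [h3]
      refine Complex.mem_slitPlane_of_norm_lt_one ?_
      rw [norm_div, div_lt_one (hρ.trans_le h2)]
      have := norm_toC_le (x - x₀)
      linarith
    · have h4 : ‖x₀ - y‖ ≤ ‖x - y‖ + ‖x - x₀‖ := by
        rw [show x₀ - y = (x - y) - (x - x₀) by abel]
        exact norm_sub_le _ _
      linarith
  have hx₀ : x₀ ∈ Metric.ball x₀ (ρ / 4) := Metric.mem_ball_self (by positivity)
  set F : Plane → Plane → ℝ := fun x y =>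
    f y * ((2 * Real.pi)⁻¹ * (toC (x - y) / toC (x₀ - y)).arg) with hF
  have hmeas : ∀ x, AEStronglyMeasurable (F x) (volume.restrict K) := fun x => by
    refine (hf.1.mul (Measurable.aestronglyMeasurable ?_)).restrict
    refine measurable_const.mul (Complex.measurable_arg.comp ?_)
    have := toC.measurable
    exact (this.comp (measurable_const.sub measurable_id)).div
      (this.comp (measurable_const.sub measurable_id))
  refine ⟨ρ / 4, by positivity, fun x => ∫ y in K, F x y, fun x hxx => ?_⟩
  refine hasFDerivAt_integral_of_dominated_of_fderiv_le (𝕜 := ℝ)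
    (F' := fun x y => f y • biotSavart (x - y)) (bound := fun y => |f y| * (2 * (ρ / 2)⁻¹))
    (Metric.isOpen_ball.mem_nhds hxx) (Eventually.of_forall hmeas) ?_ ?_ ?_ ?_ ?_
  · refine (hf.norm.mul_const 1).restrict.mono' (hmeas x) (ae_of_all _ fun y => ?_)
    have hpi := Real.pi_pos
    have h1 := Complex.abs_arg_le_pi (toC (x - y) / toC (x₀ - y))
    simp only [hF, norm_mul]
    gcongr
    rw [Real.norm_eq_abs, Real.norm_eq_abs, abs_of_pos (by positivity),
      inv_mul_le_one₀ (by positivity)]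
    linarith
  · refine (hf.1.smul (Measurable.aestronglyMeasurable ?_)).restrict
    exact measurable_biotSavart.comp (measurable_const.sub measurable_id)
  · refine (ae_restrict_iff' hK).2 (ae_of_all _ fun y hy z hz => ?_)
    rw [norm_smul, Real.norm_eq_abs]
    have h1 := (hnear z hz y hy).2.2
    refine mul_le_mul_of_nonneg_left ((norm_biotSavart_le _).trans ?_) (abs_nonneg _)
    gcongr
  · exact (hf.abs.mul_const _).restrict
  · refine (ae_restrict_iff' hK).2 (ae_of_all _ fun y hy z hz => ?_)
    obtain ⟨h1, h2, -⟩ := hnear z hz y hy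
    exact (hasFDerivAt_arg_toC h2 h1).const_mul (f y)

/-- Hölder bound for the Biot-Savart field, uniform over a bounded region. -/
lemma exists_norm_integral_biotSavart_le {p : ℝ} (hp : 2 < p) (R : ℝ) :
    ∃ C > 0, ∀ f : Plane → ℝ, Continuous f → HasCompactSupport f → ∀ V ⊆ Metric.ball (0 : Plane) R,
      MeasurableSet V → ∀ x ∈ Metric.ball (0 : Plane) R,
        ‖∫ y in V, f y • biotSavart (x - y)‖ ≤ C * (∫ y in V, |f y| ^ p) ^ (1 / p) := by
  set q := p.conjExponent with hq
  have hpq : p.HolderConjugate q := Real.HolderConjugate.conjExponent (by linarith)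
  have hq0 : 0 < q := hpq.symm.pos
  have hq2 : q < 2 := by
    rw [hq, Real.conjExponent, div_lt_iff₀ (by linarith)]
    linarith
  set k : Plane → ℝ := (Metric.ball 0 (2 * R)).indicator fun t => ‖t‖⁻¹ with hk
  have hkm : Measurable k := measurable_norm.inv.indicator measurableSet_ball
  have hk0 : ∀ t, 0 ≤ k t := fun t => indicator_nonneg (fun _ _ => by positivity) t
  have hkq : (fun t => k t ^ q) = (Metric.ball 0 (2 * R)).indicator fun t => ‖t‖ ^ (-q) := by
    ext t
    by_cases ht : t ∈ Metric.ball (0 : Plane) (2 * R)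
    · simp only [hk, indicator_of_mem ht]
      rw [Real.inv_rpow (norm_nonneg _), Real.rpow_neg (norm_nonneg _)]
    · simp only [hk, indicator_of_notMem ht]
      exact Real.zero_rpow hq0.ne'
  have hki : Integrable fun t => k t ^ q := by
    rw [hkq]
    exact (integrableOn_norm_rpow_neg hq2 (2 * R)).integrable_indicator measurableSet_ball
  set D := ∫ t, k t ^ q with hD
  have hD0 : 0 ≤ D := integral_nonneg fun t => Real.rpow_nonneg (hk0 t) _
  have hEq := hpq.ennrealOfReal
  refine ⟨2 * D ^ (1 / q) + 1, by positivity, fun f hf hfs V hV hVm x hx => ?_⟩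
  have hfi : 0 ≤ (∫ y in V, |f y| ^ p) ^ (1 / p) :=
    Real.rpow_nonneg (integral_nonneg fun y => by positivity) _
  have hg1 : MemLp (fun y => |f y|) (ENNReal.ofReal p) (volume.restrict V) :=
    ((hf.memLp_of_hasCompactSupport hfs).abs).restrict V
  have hgm : AEStronglyMeasurable (fun y => k (x - y)) (volume.restrict V) :=
    (hkm.comp (measurable_const.sub measurable_id)).aestronglyMeasurable
  have hki' : Integrable (fun y => k (x - y) ^ q) := hki.comp_sub_left x
  have hg2 : MemLp (fun y => k (x - y)) (ENNReal.ofReal q) (volume.restrict V) := by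
    rw [← integrable_norm_rpow_iff hgm (by simpa using hq0) ENNReal.ofReal_ne_top,
      ENNReal.toReal_ofReal hq0.le]
    refine hki'.restrict.congr (ae_of_all _ fun y => ?_)
    simp only [Real.norm_eq_abs, abs_of_nonneg (hk0 _)]
  have hH := integral_mul_le_Lp_mul_Lq_of_nonneg hpq (ae_of_all _ fun y => abs_nonneg (f y))
    (ae_of_all _ fun y => hk0 (x - y)) hg1 hg2
  have hDle : (∫ y in V, k (x - y) ^ q) ^ (1 / q) ≤ D ^ (1 / q) := by
    refine Real.rpow_le_rpow (integral_nonneg fun y => Real.rpow_nonneg (hk0 _) _) ?_ (by positivity)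
    rw [hD, ← integral_sub_left_eq_self _ volume x]
    exact setIntegral_le_integral hki' (ae_of_all _ fun y => Real.rpow_nonneg (hk0 _) _)
  have hbound : ‖∫ y in V, f y • biotSavart (x - y)‖ ≤ ∫ y in V, |f y| * k (x - y) * 2 := by
    refine norm_integral_le_of_norm_le ((hg1.integrable_mul hg2).mul_const 2) ?_
    refine (ae_restrict_iff' hVm).2 (ae_of_all _ fun y hy => ?_)
    have hmem : x - y ∈ Metric.ball (0 : Plane) (2 * R) := by
      have h1 := hV hy
      rw [mem_ball_zero_iff] at h1 hx ⊢
      linarith [norm_sub_le x y]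
    rw [norm_smul, Real.norm_eq_abs, hk, indicator_of_mem hmem, mul_assoc]
    gcongr
    rw [mul_comm]
    exact norm_biotSavart_le _
  rw [integral_mul_const] at hbound
  nlinarith [mul_le_mul_of_nonneg_left hDle hfi]

lemma BoundaryParam.volume_frontier {Ω : Set Plane} (P : BoundaryParam Ω) :
    volume (frontier Ω) = 0 := by
  have h1 : dimH (frontier Ω) < (2 : NNReal) := by
    have h := ContDiff.dimH_range_le (P.smooth.of_le (m := 1) (by simp))
    rw [P.range_eq, Module.finrank_self] at h
    exact h.trans_lt (by norm_num)
  have h2 := hausdorffMeasure_of_dimH_lt h1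
  rw [← hausdorffMeasure_prod_real]
  exact_mod_cast h2

lemma exists_setIntegral_thickening_le {Ω : Set Plane} (hΩ : volume (frontier Ω) = 0)
    {g : Plane → ℝ}
    (hg : Integrable g) {ε η : ℝ} (hε : 0 < ε) (hη : 0 < η) :
    ∃ δ, 0 < δ ∧ δ < η ∧ ∫ x in Metric.thickening δ Ω, g x ≤ (∫ x in Ω, g x) + ε := by
  have hlim : Tendsto (fun n : ℕ => ∫ x in Metric.thickening (1 / ((n : ℝ) + 1)) Ω, g x) atTop
      (𝓝 (∫ x in ⋂ n : ℕ, Metric.thickening (1 / ((n : ℝ) + 1)) Ω, g x)) := by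
    refine tendsto_setIntegral_of_antitone (fun n => Metric.isOpen_thickening.measurableSet)
      (fun m n hmn => Metric.thickening_mono (Nat.one_div_le_one_div hmn) Ω) ⟨0, hg.integrableOn⟩
  have hcl : ⋂ n : ℕ, Metric.thickening (1 / ((n : ℝ) + 1)) Ω = closure Ω := by
    rw [Metric.closure_eq_iInter_thickening]
    refine Subset.antisymm (subset_iInter₂ fun δ hδ => ?_)
      (subset_iInter fun n => iInter₂_subset _ Nat.one_div_pos_of_nat)
    obtain ⟨n, hn⟩ := exists_nat_one_div_lt hδ
    exact (iInter_subset _ n).trans (Metric.thickening_mono hn.le Ω)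
  rw [hcl, setIntegral_congr_set (closure_ae_eq_of_null_frontier hΩ)] at hlim
  have h1 := hlim.eventually_le_const (lt_add_of_pos_right _ hε)
  have h2 := (tendsto_one_div_add_atTop_nhds_zero_nat (𝕜 := ℝ)).eventually_lt_const hη
  obtain ⟨n, hn, hn'⟩ := (h1.and h2).exists
  exact ⟨_, Nat.one_div_pos_of_nat, hn', hn⟩

lemma exists_cutoff {K U : Set Plane} (hK : IsCompact K) (hU : IsOpen U) (hKU : K ⊆ U) :
    ∃ χ : Plane → ℝ, ContDiff ℝ 1 χ ∧ HasCompactSupport χ ∧ tsupport χ ⊆ U ∧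
      ∀ x ∈ K, χ =ᶠ[𝓝 x] 1 := by
  obtain ⟨δ, hδ, hsub⟩ := hK.exists_cthickening_subset_open hU hKU
  have hth : Metric.thickening δ K ⊆ Metric.cthickening δ K :=
    Metric.thickening_subset_cthickening δ K
  obtain ⟨f, hf0, hf1, -⟩ := exists_contMDiffMap_zero_one_nhds_of_isClosed (n := 1)
    (modelWithCornersSelf ℝ Plane) (s := (Metric.thickening δ K)ᶜ) (t := K)
    Metric.isOpen_thickening.isClosed_compl hK.isClosed
    (disjoint_compl_left_iff_subset.2 (Metric.self_subset_thickening hδ K))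
  have hts : tsupport f ⊆ Metric.thickening δ K := by
    intro x hx
    by_contra hcon
    exact notMem_tsupport_iff_eventuallyEq.2 (hf0.filter_mono (nhds_le_nhdsSet hcon)) hx
  refine ⟨f, f.contMDiff.contDiff, ?_, (hts.trans hth).trans hsub, fun x hx => ?_⟩
  · exact hK.cthickening.of_isClosed_subset (isClosed_tsupport _) (hts.trans hth)
  · exact hf1.filter_mono (nhds_le_nhdsSet hx)

lemma continuousAt_biotSavart {t : Plane} (ht : t ≠ 0) : ContinuousAt biotSavart t := by
  have h1 : esq t ≠ 0 := ((pow_pos (norm_pos_iff.2 ht) 2).trans_le (sq_norm_le_esq t)).ne'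
  have h2 : ContinuousAt newtonGrad t := by
    have h3 : Continuous fun t : Plane => 2 * Real.pi * esq t := continuous_const.mul continuous_esq
    exact (h3.continuousAt.inv₀ (mul_ne_zero (by positivity) h1)).smul continuousAt_id
  exact (h2.fst.smul continuousAt_const).sub (h2.snd.smul continuousAt_const)

lemma continuousAt_integral_far {f : Plane → ℝ} (hf : Integrable f) {K : Set Plane}
    (hK : MeasurableSet K) {x₀ : Plane} {ρ : ℝ} (hρ : 0 < ρ) (hx : ∀ y ∈ K, ρ ≤ ‖x₀ - y‖) :
    ContinuousAt (fun x => ∫ y in K, f y • biotSavart (x - y)) x₀ := by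
  refine continuousAt_of_dominated (bound := fun y => |f y| * (2 * (ρ / 2)⁻¹))
    (Eventually.of_forall fun x => ?_) ?_ (hf.abs.mul_const _).restrict ?_
  · refine (hf.1.smul (Measurable.aestronglyMeasurable ?_)).restrict
    exact measurable_biotSavart.comp (measurable_const.sub measurable_id)
  · filter_upwards [Metric.ball_mem_nhds x₀ (half_pos hρ)] with x hxx
    refine (ae_restrict_iff' hK).2 (ae_of_all _ fun y hy => ?_)
    rw [norm_smul, Real.norm_eq_abs]
    refine mul_le_mul_of_nonneg_left ((norm_biotSavart_le _).trans ?_) (abs_nonneg _)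
    have h1 : ‖x₀ - y‖ ≤ ‖x - y‖ + ‖x - x₀‖ := by
      rw [show x₀ - y = (x - y) - (x - x₀) by abel]
      exact norm_sub_le _ _
    have h2 := hx y hy
    rw [mem_ball_iff_norm] at hxx
    have h3 : ρ / 2 ≤ ‖x - y‖ := by linarith
    gcongr
  · refine (ae_restrict_iff' hK).2 (ae_of_all _ fun y hy => ?_)
    have h1 : x₀ - y ≠ 0 := norm_pos_iff.1 (hρ.trans_le (hx y hy))
    exact ((continuousAt_biotSavart h1).comp
      (f := fun x : Plane => x - y) (continuousAt_id.sub continuousAt_const)).const_smul (f y)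

lemma contDiffOn_one_of_hasFDerivAt {E : Type*} [NormedAddCommGroup E] [NormedSpace ℝ E]
    {φ : E → ℝ} {h : E → E →L[ℝ] ℝ} {U : Set E} (hU : IsOpen U)
    (hφ : ∀ x ∈ U, HasFDerivAt φ (h x) x) (hc : ∀ x ∈ U, ContinuousAt h x) :
    ContDiffOn ℝ 1 φ U := by
  rw [show (1 : WithTop ℕ∞) = 0 + 1 by norm_num, contDiffOn_succ_iff_fderiv_of_isOpen hU]
  refine ⟨fun x hx => (hφ x hx).differentiableAt.differentiableWithinAt, by simp, ?_⟩
  rw [contDiffOn_zero]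
  exact ContinuousOn.congr (fun x hx => (hc x hx).continuousWithinAt) fun x hx => (hφ x hx).fderiv

/-- Extension by zero, after a cutoff, of a `C¹` function near the closure of `Ω`. -/
lemma contDiff_cutoff_mul {U : Set Plane} (hU : IsOpen U) {χ w : Plane → ℝ} (hχ : ContDiff ℝ 1 χ)
    (hs : tsupport χ ⊆ U) (hw : ContDiffOn ℝ 1 w U) : ContDiff ℝ 1 (fun x => χ x * w x) := by
  refine contDiff_iff_contDiffAt.2 fun x => ?_
  by_cases hx : x ∈ tsupport χ
  · exact hχ.contDiffAt.mul (hw.contDiffAt (hU.mem_nhds (hs hx)))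
  · refine (contDiffAt_const (c := (0 : ℝ))).congr_of_eventuallyEq ?_
    filter_upwards [notMem_tsupport_iff_eventuallyEq.1 hx] with y hy
    simp [hy]

lemma contDiff_F0 : ContDiff ℝ 1 F0 := by unfold F0; fun_prop

lemma curl2_F0 (x : Plane) : curl2 F0 x = 1 := by
  have h1 : HasFDerivAt (fun y : Plane => (F0 y).2)
      ((2 : ℝ)⁻¹ • ContinuousLinearMap.fst ℝ ℝ ℝ) x := by
    have := (hasFDerivAt_fst (𝕜 := ℝ) (p := x)).const_smul (2 : ℝ)⁻¹
    refine this.congr_of_eventuallyEq (Eventually.of_forall fun y => ?_)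
    simp [F0, div_eq_inv_mul]
  have h2 : HasFDerivAt (fun y : Plane => (F0 y).1)
      ((-2 : ℝ)⁻¹ • ContinuousLinearMap.snd ℝ ℝ ℝ) x := by
    have := (hasFDerivAt_snd (𝕜 := ℝ) (p := x)).const_smul (-2 : ℝ)⁻¹
    refine this.congr_of_eventuallyEq (Eventually.of_forall fun y => ?_)
    simp [F0]
    ring
  rw [curl2, h1.fderiv, h2.fderiv]
  norm_num

/-- Up to a gauge transformation, `A` differs from `F0` by at most the `L^p` norm of
`curl A - 1`. -/
lemma exists_gauge {Ω : Set Plane} (hΩ : IsOpen Ω) (hb : Bornology.IsBounded Ω)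
    [SimplyConnectedSpace Ω] (P : BoundaryParam Ω) {p : ℝ} (hp : 2 < p) :
    ∃ C > 0, ∀ A : Plane → Plane, CNearCl 1 Ω A → ∀ ε > 0, ∃ φ : Plane → ℝ, CNearCl 1 Ω φ ∧
      ∀ x ∈ Ω, ∀ v : Plane, |(A x - F0 x).1 * v.1 + (A x - F0 x).2 * v.2 - fderiv ℝ φ x v| ≤
        C * ((∫ x in Ω, |curl2 A x - 1| ^ p) + ε) ^ (1 / p) * ‖v‖ := by
  obtain ⟨R, hR⟩ := hb.subset_ball (0 : Plane)
  obtain ⟨C, hC, hbound⟩ := exists_norm_integral_biotSavart_le hp (R + 1)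
  refine ⟨C, hC, ?_⟩
  rintro A ⟨U, hU, hΩU, hA⟩ ε hε
  obtain ⟨χ, hχ, hχc, hχU, hχ1⟩ := exists_cutoff hb.isCompact_closure hU hΩU
  have hAF : ContDiffOn ℝ 1 (fun x => A x - F0 x) U := hA.sub contDiff_F0.contDiffOn
  set w₁ : Plane → ℝ := fun x => χ x * (A x - F0 x).1 with hw₁
  set w₂ : Plane → ℝ := fun x => χ x * (A x - F0 x).2 with hw₂
  have hd₁ : ContDiff ℝ 1 w₁ := contDiff_cutoff_mul hU hχ hχU hAF.fst
  have hd₂ : ContDiff ℝ 1 w₂ := contDiff_cutoff_mul hU hχ hχU hAF.snd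
  have hs₁ : HasCompactSupport w₁ := hχc.mul_right
  have hs₂ : HasCompactSupport w₂ := hχc.mul_right
  obtain ⟨φ₀, hφ₀, hdφ₀⟩ := exists_helmholtz hd₁ hs₁ hd₂ hs₂
  set f : Plane → ℝ := fun y => fderiv ℝ w₂ y (1, 0) - fderiv ℝ w₁ y (0, 1) with hf
  have hfc : Continuous f :=
    ((hd₂.continuous_fderiv (by simp)).clm_apply continuous_const).sub
      ((hd₁.continuous_fderiv (by simp)).clm_apply continuous_const)
  have hfs : HasCompactSupport f := (hs₂.fderiv_apply ℝ _).sub (hs₁.fderiv_apply ℝ _)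
  have hfi : Integrable f := hfc.integrable_of_hasCompactSupport hfs
  have hfΩ : ∀ x ∈ Ω, f x = curl2 A x - 1 := by
    intro x hx
    have hx' := subset_closure hx
    have hAx : DifferentiableAt ℝ A x :=
      (hA.contDiffAt (hU.mem_nhds (hΩU hx'))).differentiableAt (by simp)
    have hFx : DifferentiableAt ℝ F0 x := contDiff_F0.differentiable (by simp) x
    have e₁ : w₁ =ᶠ[𝓝 x] fun y => (A y).1 - (F0 y).1 := by
      filter_upwards [hχ1 x hx'] with y hy
      simp [hw₁, hy]
    have e₂ : w₂ =ᶠ[𝓝 x] fun y => (A y).2 - (F0 y).2 := by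
      filter_upwards [hχ1 x hx'] with y hy
      simp [hw₂, hy]
    have h1 := curl2_F0 x
    simp only [hf]
    rw [e₁.fderiv_eq, e₂.fderiv_eq, fderiv_fun_sub hAx.fst hFx.fst, fderiv_fun_sub hAx.snd hFx.snd,
      curl2]
    rw [curl2] at h1
    simp only [sub_apply]
    linarith
  have hpos : ∀ y, 0 ≤ |f y| ^ p := fun y => by positivity
  have hgi : Integrable fun y => |f y| ^ p := by
    refine Continuous.integrable_of_hasCompactSupport ?_ ?_
    · exact hfc.abs.rpow_const fun y => Or.inr (by linarith)
    · exact hfs.comp_left (g := fun s : ℝ => |s| ^ p)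
          (by simp [Real.zero_rpow (by linarith : p ≠ 0)])
  obtain ⟨δ, hδ, hδ1, hδε⟩ := exists_setIntegral_thickening_le P.volume_frontier hgi hε one_pos
  set V := Metric.thickening δ Ω with hV
  have hVm : MeasurableSet V := Metric.isOpen_thickening.measurableSet
  have hVR : V ⊆ Metric.ball 0 (R + 1) := by
    intro y hy
    obtain ⟨z, hz, hyz⟩ := Metric.mem_thickening_iff.1 hy
    have h1 := hR hz
    rw [Metric.mem_ball] at h1 ⊢
    linarith [dist_triangle y z 0]
  have hfar : ∀ x ∈ Metric.thickening (δ / 2) Ω, ∀ y ∈ Vᶜ, δ / 2 ≤ ‖x - y‖ := by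
    intro x hx y hy
    obtain ⟨z, hz, hxz⟩ := Metric.mem_thickening_iff.1 hx
    by_contra! hcon
    refine hy (Metric.mem_thickening_iff.2 ⟨z, hz, ?_⟩)
    rw [← dist_eq_norm, dist_comm] at hcon
    linarith [dist_triangle y x z]
  have hcl : closure Ω ⊆ Metric.thickening (δ / 2) Ω :=
    Metric.closure_subset_thickening (by positivity) Ω
  set h : Plane → Plane →L[ℝ] ℝ := fun x => ∫ y in Vᶜ, f y • biotSavart (x - y) with hh
  have hloc : ∀ x ∈ closure Ω, ∃ r > 0, ∃ ψ : Plane → ℝ, ∀ y ∈ Metric.ball x r,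
      HasFDerivAt ψ (h y) y := fun x hx =>
    exists_primitive_far hfi hVm.compl (half_pos hδ) (hfar x (hcl hx))
  obtain ⟨φ₁, hφ₁⟩ := exists_primitive_of_simplyConnected hΩ fun x hx => hloc x (subset_closure hx)
  obtain ⟨U₁, Φ, hU₁, hΩU₁, hΦ⟩ := exists_primitive_nhds_closure hΩ hφ₁ hloc
    (P.locally_connected hΩ hb)
  have hΦc : ContDiffOn ℝ 1 Φ (U₁ ∩ Metric.thickening (δ / 2) Ω) :=
    contDiffOn_one_of_hasFDerivAt (hU₁.inter Metric.isOpen_thickening) (fun x hx => hΦ x hx.1)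
      fun x hx => continuousAt_integral_far hfi hVm.compl (half_pos hδ) (hfar x hx.2)
  refine ⟨fun x => φ₀ x + Φ x, ⟨_, hU₁.inter Metric.isOpen_thickening, subset_inter hΩU₁ hcl,
    hφ₀.contDiffOn.add hΦc⟩, fun x hx v => ?_⟩
  have hx' := subset_closure hx
  have hder : fderiv ℝ (fun x => φ₀ x + Φ x) x = fderiv ℝ φ₀ x + h x :=
    ((hφ₀.differentiable (by simp) x).hasFDerivAt.add (hΦ x (hΩU₁ hx'))).fderiv
  have hχx : χ x = 1 := (hχ1 x hx').self_of_nhds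
  have hGi := integrable_mul_biotSavart hfc hfs x
  have hsplit : ∫ y, f y * biotSavart (x - y) v =
      (∫ y in V, f y • biotSavart (x - y)) v + h x v := by
    rw [hh, ← add_apply, integral_add_compl hVm hGi, ContinuousLinearMap.integral_apply hGi]
    rfl
  have hmain : (A x - F0 x).1 * v.1 + (A x - F0 x).2 * v.2 - fderiv ℝ (fun x => φ₀ x + Φ x) x v =
      (∫ y in V, f y • biotSavart (x - y)) v := by
    have h1 := hdφ₀ x v
    rw [hsplit] at h1
    simp only [hw₁, hw₂, hχx, one_mul] at h1
    rw [hder, add_apply, h1]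
    ring
  rw [hmain, ← Real.norm_eq_abs]
  refine (ContinuousLinearMap.le_opNorm _ v).trans ?_
  gcongr
  have hxR : x ∈ Metric.ball (0 : Plane) (R + 1) := Metric.ball_subset_ball (by linarith) (hR hx)
  refine (hbound f hfc hfs V hVR hVm x hxR).trans ?_
  refine mul_le_mul_of_nonneg_left (Real.rpow_le_rpow (integral_nonneg fun y => hpos y) ?_
    (by positivity)) hC.le
  refine hδε.trans_eq ?_
  rw [setIntegral_congr_fun hΩ.measurableSet fun y hy => by rw [hfΩ y hy]]

lemma CNearCl.continuousOn {E : Type*} [NormedAddCommGroup E] [NormedSpace ℝ E] {Ω : Set Plane}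
    {u : Plane → E} (hu : CNearCl 1 Ω u) : ContinuousOn u (closure Ω) := by
  obtain ⟨U, -, hΩU, hu⟩ := hu
  exact hu.continuousOn.mono hΩU

lemma CNearCl.differentiableAt {E : Type*} [NormedAddCommGroup E] [NormedSpace ℝ E] {Ω : Set Plane}
    {u : Plane → E} (hu : CNearCl 1 Ω u) {x : Plane} (hx : x ∈ Ω) : DifferentiableAt ℝ u x := by
  obtain ⟨U, hU, hΩU, hu⟩ := hu
  exact (hu.contDiffAt (hU.mem_nhds (hΩU (subset_closure hx)))).differentiableAt (by simp)

lemma CNearCl.continuousOn_fderiv {E : Type*} [NormedAddCommGroup E] [NormedSpace ℝ E]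
    {Ω : Set Plane} {u : Plane → E} (hu : CNearCl 1 Ω u) :
    ContinuousOn (fderiv ℝ u) (closure Ω) := by
  obtain ⟨U, hU, hΩU, hu⟩ := hu
  exact (hu.continuousOn_fderiv_of_isOpen hU (by simp)).mono hΩU

lemma integrableOn_of_continuousOn_closure {Ω : Set Plane} (hb : Bornology.IsBounded Ω)
    {g : Plane → ℝ} (hg : ContinuousOn g (closure Ω)) : IntegrableOn g Ω :=
  (hg.integrableOn_compact hb.isCompact_closure).mono_set subset_closure

lemma integrableOn_magSq {Ω : Set Plane} (hb : Bornology.IsBounded Ω) (B : ℝ) {A : Plane → Plane}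
    {u : Plane → ℂ} (hA : ContinuousOn A (closure Ω)) (hu : CNearCl 1 Ω u) :
    IntegrableOn (magSq B A u) Ω := by
  refine integrableOn_of_continuousOn_closure hb ?_
  have h1 := hu.continuousOn
  have h2 := hu.continuousOn_fderiv
  have h3 : ContinuousOn (fun x => ((B * (A x).1 : ℝ) : ℂ)) (closure Ω) :=
    Complex.continuous_ofReal.comp_continuousOn (continuousOn_const.mul hA.fst)
  have h4 : ContinuousOn (fun x => ((B * (A x).2 : ℝ) : ℂ)) (closure Ω) :=
    Complex.continuous_ofReal.comp_continuousOn (continuousOn_const.mul hA.snd)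
  exact (((continuousOn_const.mul (h2.clm_apply continuousOn_const)).sub (h3.mul h1)).norm.pow 2).add
    (((continuousOn_const.mul (h2.clm_apply continuousOn_const)).sub (h4.mul h1)).norm.pow 2)

lemma integrableOn_norm_sq {Ω : Set Plane} (hb : Bornology.IsBounded Ω) {u : Plane → ℂ}
    (hu : CNearCl 1 Ω u) : IntegrableOn (fun x => ‖u x‖ ^ 2) Ω :=
  integrableOn_of_continuousOn_closure hb (hu.continuousOn.norm.pow 2)

lemma magSq_nonneg (B : ℝ) (A : Plane → Plane) (u : Plane → ℂ) (x : Plane) : 0 ≤ magSq B A u x := by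
  unfold magSq; positivity

lemma lam1A_mul_le {Ω : Set Plane} {B : ℝ} {A : Plane → Plane} {u : Plane → ℂ}
    (hu : CNearCl 1 Ω u) : lam1A Ω B A * ∫ x in Ω, ‖u x‖ ^ 2 ≤ ∫ x in Ω, magSq B A u x := by
  have hbd : BddBelow { r : ℝ | ∃ u : Plane → ℂ, CNearCl 1 Ω u ∧ (∫ x in Ω, ‖u x‖ ^ 2) ≠ 0 ∧
      r = (∫ x in Ω, magSq B A u x) / (∫ x in Ω, ‖u x‖ ^ 2) } := by
    refine ⟨0, ?_⟩
    rintro r ⟨v, -, -, rfl⟩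
    exact div_nonneg (integral_nonneg fun x => magSq_nonneg B A v x)
      (integral_nonneg fun x => by positivity)
  have hnn : 0 ≤ ∫ x in Ω, ‖u x‖ ^ 2 := integral_nonneg fun x => by positivity
  rcases hnn.eq_or_lt with h0 | h0
  · rw [← h0, mul_zero]
    exact integral_nonneg fun x => magSq_nonneg B A u x
  · rw [← le_div_iff₀ h0]
    exact csInf_le hbd ⟨u, hu, h0.ne', rfl⟩

lemma le_lam1A {Ω : Set Plane} (hΩ : IsOpen Ω) (hne : Ω.Nonempty) (hb : Bornology.IsBounded Ω)
    {B m : ℝ} {A : Plane → Plane} (h : ∀ u : Plane → ℂ, CNearCl 1 Ω u → 0 < ∫ x in Ω, ‖u x‖ ^ 2 →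
      m ≤ (∫ x in Ω, magSq B A u x) / ∫ x in Ω, ‖u x‖ ^ 2) : m ≤ lam1A Ω B A := by
  refine le_csInf ⟨_, fun _ => 1, ⟨univ, isOpen_univ, subset_univ _, contDiffOn_const⟩, ?_, rfl⟩ ?_
  · have h1 : 0 < volume.real Ω :=
      ENNReal.toReal_pos (hΩ.measure_pos volume hne).ne' hb.measure_lt_top.ne
    simpa using h1.ne'
  · rintro r ⟨u, hu, hu0, rfl⟩
    exact h u hu (lt_of_le_of_ne (integral_nonneg fun x => by positivity) hu0.symm)

/-- Gauge covariance of the magnetic gradient. -/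
lemma magSq_gauge (B : ℝ) (A : Plane → Plane) {φ : Plane → ℝ} {u : Plane → ℂ} {x : Plane}
    (hφ : DifferentiableAt ℝ φ x) (hu : DifferentiableAt ℝ u x) :
    magSq B A (fun y => Complex.exp (-Complex.I * (B * φ y : ℝ)) * u y) x =
      magSq B (fun y => A y + (fderiv ℝ φ y (1, 0), fderiv ℝ φ y (0, 1))) u x := by
  have h1 : HasFDerivAt (fun y => -Complex.I * ((B * φ y : ℝ) : ℂ))
      ((-Complex.I) • Complex.ofRealCLM.comp (B • fderiv ℝ φ x)) x :=
    (Complex.ofRealCLM.hasFDerivAt.comp x (hφ.hasFDerivAt.const_mul B)).const_mul (-Complex.I)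
  have h2 : HasFDerivAt (fun y => Complex.exp (-Complex.I * (B * φ y : ℝ)) * u y) _ x :=
    h1.cexp.mul hu.hasFDerivAt
  have h3 : ∀ v : Plane, ∀ a : ℝ, ‖(-Complex.I) * fderiv ℝ
      (fun y => Complex.exp (-Complex.I * (B * φ y : ℝ)) * u y) x v - ((B * a : ℝ) : ℂ) *
      (Complex.exp (-Complex.I * (B * φ x : ℝ)) * u x)‖ =
      ‖(-Complex.I) * fderiv ℝ u x v - ((B * (a + fderiv ℝ φ x v) : ℝ) : ℂ) * u x‖ := by
    intro v a
    have h4 : ‖Complex.exp (-Complex.I * (B * φ x : ℝ))‖ = 1 := by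
      rw [Complex.norm_exp]; simp
    rw [← one_mul ‖(-Complex.I) * fderiv ℝ u x v - _‖, ← h4, ← norm_mul]
    congr 1
    rw [h2.fderiv]
    simp
    linear_combination ((B : ℂ) * Complex.exp (-(Complex.I * (B * φ x))) * (fderiv ℝ φ x v : ℂ) *
      u x) * Complex.I_sq
  simp only [magSq, h3, Prod.fst_add, Prod.snd_add]

lemma CNearCl.exp_mul {Ω : Set Plane} (B : ℝ) {φ : Plane → ℝ} {u : Plane → ℂ} (hφ : CNearCl 1 Ω φ)
    (hu : CNearCl 1 Ω u) :
    CNearCl 1 Ω fun y => Complex.exp (-Complex.I * (B * φ y : ℝ)) * u y := by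
  obtain ⟨U, hU, hΩU, hφ⟩ := hφ
  obtain ⟨V, hV, hΩV, hu⟩ := hu
  refine ⟨U ∩ V, hU.inter hV, subset_inter hΩU hΩV, ?_⟩
  have h1 : ContDiffOn ℝ 1 (fun y => ((B * φ y : ℝ) : ℂ)) (U ∩ V) :=
    Complex.ofRealCLM.contDiff.comp_contDiffOn
      (contDiffOn_const.mul (hφ.mono inter_subset_left))
  exact (contDiffOn_const.mul h1).cexp.mul (hu.mono inter_subset_right)

lemma norm_exp_neg_I_mul (s : ℝ) (z : ℂ) : ‖Complex.exp (-Complex.I * (s : ℝ)) * z‖ = ‖z‖ := by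
  rw [norm_mul, Complex.norm_exp]; simp

lemma norm_sub_mul_sq_le {t : ℝ} (ht : 0 < t) (P z : ℂ) {a M : ℝ} (ha : |a| ≤ M) :
    ‖P + (a : ℂ) * z‖ ^ 2 ≤ (1 + t) * ‖P‖ ^ 2 + (1 + t⁻¹) * (M ^ 2 * ‖z‖ ^ 2) := by
  have h1 : ‖P + (a : ℂ) * z‖ ≤ ‖P‖ + M * ‖z‖ := by
    refine (norm_add_le _ _).trans ?_
    rw [norm_mul, Complex.norm_real, Real.norm_eq_abs]
    gcongr
  have h2 := pow_le_pow_left₀ (norm_nonneg _) h1 2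
  have h3 : 2 * (‖P‖ * (M * ‖z‖)) ≤ t * ‖P‖ ^ 2 + t⁻¹ * (M * ‖z‖) ^ 2 := by
    have h4 : t⁻¹ * (t * ‖P‖ - M * ‖z‖) ^ 2 = t * ‖P‖ ^ 2 + t⁻¹ * (M * ‖z‖) ^ 2
        - 2 * (‖P‖ * (M * ‖z‖)) := by
      field_simp
      ring
    have h5 : 0 ≤ t⁻¹ * (t * ‖P‖ - M * ‖z‖) ^ 2 := by positivity
    linarith
  nlinarith

lemma lam1_mul_le {Ω : Set Plane} (hΩ : IsOpen Ω) (hb : Bornology.IsBounded Ω) {B M t : ℝ}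
    (hB : 0 < B) (ht : 0 < t) {A : Plane → Plane} (hA : CNearCl 1 Ω A) {φ : Plane → ℝ}
    (hφ : CNearCl 1 Ω φ)
    (h : ∀ x ∈ Ω, ∀ v : Plane,
      |(A x - F0 x).1 * v.1 + (A x - F0 x).2 * v.2 - fderiv ℝ φ x v| ≤ M * ‖v‖)
    {u : Plane → ℂ} (hu : CNearCl 1 Ω u) :
    lam1 Ω B * ∫ x in Ω, ‖u x‖ ^ 2 ≤ (1 + t) * (∫ x in Ω, magSq B A u x) +
      (1 + t⁻¹) * (2 * B * M) ^ 2 * ∫ x in Ω, ‖u x‖ ^ 2 := by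
  set v : Plane → ℂ := fun y => Complex.exp (-Complex.I * (B * φ y : ℝ)) * u y with hv
  have hvC : CNearCl 1 Ω v := hφ.exp_mul B hu
  have h1 := lam1A_mul_le (B := B) (A := F0) hvC
  simp only [hv, norm_exp_neg_I_mul] at h1
  have hpt : ∀ x ∈ Ω, magSq B F0 v x ≤
      (1 + t) * magSq B A u x + (1 + t⁻¹) * (2 * B * M) ^ 2 * ‖u x‖ ^ 2 := by
    intro x hx
    rw [hv, magSq_gauge B F0 (hφ.differentiableAt hx) (hu.differentiableAt hx)]
    have e₁ := h x hx (1, 0)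
    have e₂ := h x hx (0, 1)
    simp only [mul_one, mul_zero, add_zero, zero_add, Prod.norm_mk, norm_one, norm_zero,
      Prod.fst_sub, Prod.snd_sub, zero_le_one, sup_of_le_left, sup_of_le_right] at e₁ e₂
    have e₁' : |B * ((A x).1 - (F0 x).1 - fderiv ℝ φ x (1, 0))| ≤ B * M := by
      rw [abs_mul, abs_of_pos hB]; gcongr
    have e₂' : |B * ((A x).2 - (F0 x).2 - fderiv ℝ φ x (0, 1))| ≤ B * M := by
      rw [abs_mul, abs_of_pos hB]; gcongr
    have b₁ := norm_sub_mul_sq_le ht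
      ((-Complex.I) * fderiv ℝ u x (1, 0) - ((B * (A x).1 : ℝ) : ℂ) * u x) (u x) e₁'
    have b₂ := norm_sub_mul_sq_le ht
      ((-Complex.I) * fderiv ℝ u x (0, 1) - ((B * (A x).2 : ℝ) : ℂ) * u x) (u x) e₂'
    simp only [magSq, Prod.fst_add, Prod.snd_add]
    have r₁ : (-Complex.I) * fderiv ℝ u x (1, 0) - ((B * ((F0 x).1 + fderiv ℝ φ x (1, 0)) : ℝ) : ℂ) *
        u x = (-Complex.I) * fderiv ℝ u x (1, 0) - ((B * (A x).1 : ℝ) : ℂ) * u x +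
        ((B * ((A x).1 - (F0 x).1 - fderiv ℝ φ x (1, 0)) : ℝ) : ℂ) * u x := by
      push_cast; ring
    have r₂ : (-Complex.I) * fderiv ℝ u x (0, 1) - ((B * ((F0 x).2 + fderiv ℝ φ x (0, 1)) : ℝ) : ℂ) *
        u x = (-Complex.I) * fderiv ℝ u x (0, 1) - ((B * (A x).2 : ℝ) : ℂ) * u x +
        ((B * ((A x).2 - (F0 x).2 - fderiv ℝ φ x (0, 1)) : ℝ) : ℂ) * u x := by
      push_cast; ring
    rw [r₁, r₂]
    have h0 : 0 ≤ (1 + t⁻¹) * ((B * M) ^ 2 * ‖u x‖ ^ 2) := by positivity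
    linarith
  have hi₁ := (integrableOn_magSq hb B hA.continuousOn hu).const_mul (1 + t)
  have hi₂ := (integrableOn_norm_sq hb hu).const_mul ((1 + t⁻¹) * (2 * B * M) ^ 2)
  have hF0 : Continuous F0 := by unfold F0; fun_prop
  have h2 := setIntegral_mono_on (integrableOn_magSq hb B hF0.continuousOn hvC) (hi₁.add hi₂)
    hΩ.measurableSet hpt
  simp only [Pi.add_apply] at h2
  rw [integral_add hi₁ hi₂, integral_const_mul, integral_const_mul] at h2
  exact h1.trans h2

lemma sub_le_of_forall_pos {q m s d : ℝ} (hq : 0 ≤ q) (hs : 0 < s) (hm : m ≤ s ^ 2) (hd : 0 < d)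
    (h : ∀ t > 0, m ≤ (1 + t) * q + (1 + t⁻¹) * d ^ 2) : m - 3 * (d * s) ≤ q := by
  by_contra! hcon
  rcases le_or_gt d s with hds | hds
  · have h1 := h (d / s) (by positivity)
    have h2 : (1 + d / s) * q + (1 + (d / s)⁻¹) * d ^ 2 = q + d / s * q + d ^ 2 + d * s := by
      field_simp
      ring
    have h3 : q ≤ s ^ 2 := by nlinarith [mul_pos hd hs]
    have h4 : d / s * q ≤ d * s := by
      calc d / s * q ≤ d / s * s ^ 2 := by gcongr
        _ = d * s := by field_simp
    nlinarith
  · nlinarith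

lemma fderiv_dot (a : Plane) (x v : Plane) :
    fderiv ℝ (fun y : Plane => -(a.1 * y.1 + a.2 * y.2)) x v = -(a.1 * v.1 + a.2 * v.2) := by
  have h : HasFDerivAt (fun y : Plane => -(a.1 * y.1 + a.2 * y.2))
      (-(a.1 • ContinuousLinearMap.fst ℝ ℝ ℝ + a.2 • ContinuousLinearMap.snd ℝ ℝ ℝ)) x :=
    ((hasFDerivAt_fst.const_mul a.1).add (hasFDerivAt_snd.const_mul a.2)).neg
  rw [h.fderiv]
  simp

/-- The ground state energy grows at most linearly in the field strength. -/
lemma exists_lam1_le {Ω : Set Plane} (hΩ : IsOpen Ω) (hne : Ω.Nonempty)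
    (hb : Bornology.IsBounded Ω) : ∃ B₀ > 0, ∃ C > 0, ∀ B ≥ B₀, lam1 Ω B ≤ C * B := by
  obtain ⟨x₀, hx₀⟩ := hne
  obtain ⟨r₀, hr₀, hball⟩ := Metric.isOpen_iff.1 hΩ x₀ hx₀
  let η : ContDiffBump (0 : Plane) := ⟨1 / 2, 1, by norm_num, by norm_num⟩
  have hη1 : ContDiff ℝ 1 (η : Plane → ℝ) := η.contDiff
  obtain ⟨M, hM⟩ : ∃ M, ∀ y, ‖fderiv ℝ (η : Plane → ℝ) y‖ ≤ M :=
    (hη1.continuous_fderiv (by simp)).bounded_above_of_compact_support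
      (η.hasCompactSupport.fderiv (𝕜 := ℝ))
  have hM0 : 0 ≤ M := (norm_nonneg _).trans (hM 0)
  refine ⟨(r₀ ^ 2)⁻¹, by positivity, 8 * (M + 1) ^ 2, by positivity, fun B hB => ?_⟩
  have hB0 : 0 < B := lt_of_lt_of_le (by positivity) hB
  set k := √B with hk
  have hk0 : 0 < k := Real.sqrt_pos.2 hB0
  have hkB : k ^ 2 = B := Real.sq_sqrt hB0.le
  have hkr : k⁻¹ ≤ r₀ := by
    rw [inv_le_comm₀ hk0 hr₀]
    refine Real.le_sqrt_of_sq_le ?_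
    rwa [inv_pow]
  let g : Plane → ℂ := fun y => (η (k • (y - x₀)) : ℂ)
  have hg : ContDiff ℝ 1 g :=
    Complex.ofRealCLM.contDiff.comp (hη1.comp (by fun_prop))
  have hgd : ∀ y v, fderiv ℝ g y v = ((k * fderiv ℝ (η : Plane → ℝ) (k • (y - x₀)) v : ℝ) : ℂ) := by
    intro y v
    have h1 : HasFDerivAt (fun y : Plane => k • (y - x₀)) (k • ContinuousLinearMap.id ℝ Plane) y :=
      ((hasFDerivAt_id y).sub_const x₀).const_smul k
    have h2 : HasFDerivAt (η : Plane → ℝ) _ (k • (y - x₀)) :=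
      (hη1.differentiable (by simp) _).hasFDerivAt
    have h3 : HasFDerivAt g _ y := Complex.ofRealCLM.hasFDerivAt.comp y
      (HasFDerivAt.comp (g := (η : Plane → ℝ)) y h2 h1)
    rw [h3.fderiv]
    simp
  have hgC : CNearCl 1 Ω g := ⟨univ, isOpen_univ, subset_univ _, hg.contDiffOn⟩
  let φ : Plane → ℝ := fun y => -((F0 x₀).1 * y.1 + (F0 x₀).2 * y.2)
  have hφ : ContDiff ℝ 1 φ := by fun_prop
  have hφC : CNearCl 1 Ω φ := ⟨univ, isOpen_univ, subset_univ _, hφ.contDiffOn⟩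
  have h1 := lam1A_mul_le (B := B) (A := F0) (hφC.exp_mul B hgC)
  simp only [norm_exp_neg_I_mul] at h1
  have hpt : ∀ x, magSq B F0 (fun y => Complex.exp (-Complex.I * (B * φ y : ℝ)) * g y) x ≤
      (Metric.closedBall x₀ k⁻¹).indicator (fun _ => 2 * (k * (M + 1)) ^ 2) x := by
    intro x
    have hscale : ‖k • (x - x₀)‖ = k * dist x x₀ := by
      rw [norm_smul, Real.norm_eq_abs, abs_of_pos hk0, dist_eq_norm]
    rw [magSq_gauge B F0 (hφ.differentiable (by simp) x) (hg.differentiable (by simp) x)]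
    by_cases hx : x ∈ Metric.closedBall x₀ k⁻¹
    · rw [indicator_of_mem hx]
      rw [Metric.mem_closedBall] at hx
      have key : ∀ v : Plane, ‖v‖ ≤ 1 → ∀ c : ℝ, |c| ≤ k⁻¹ →
          ‖(-Complex.I) * fderiv ℝ g x v - ((B * c : ℝ) : ℂ) * g x‖ ^ 2 ≤ (k * (M + 1)) ^ 2 := by
        intro v hv c hc
        refine pow_le_pow_left₀ (norm_nonneg _) ?_ 2
        have a1 : ‖(-Complex.I) * fderiv ℝ g x v‖ ≤ k * M := by
          rw [norm_mul, norm_neg, Complex.norm_I, one_mul, hgd, Complex.norm_real, norm_mul,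
            Real.norm_eq_abs, abs_of_pos hk0]
          gcongr
          exact ((fderiv ℝ (η : Plane → ℝ) _).le_opNorm v).trans
            ((mul_le_of_le_one_right (norm_nonneg _) hv).trans (hM _))
        have a2 : ‖((B * c : ℝ) : ℂ) * g x‖ ≤ k := by
          rw [norm_mul, Complex.norm_real, Complex.norm_real, norm_mul, Real.norm_eq_abs,
            Real.norm_eq_abs, Real.norm_eq_abs, abs_of_pos hB0, abs_of_nonneg η.nonneg]
          calc B * |c| * η (k • (x - x₀)) ≤ B * k⁻¹ * 1 := by
                gcongr
                exacts [η.nonneg, η.le_one]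
            _ = k := by rw [← hkB]; field_simp
        calc _ ≤ k * M + k := (norm_sub_le _ _).trans (add_le_add a1 a2)
          _ = _ := by ring
      have d1 : |x.1 - x₀.1| ≤ k⁻¹ := by
        rw [← Real.dist_eq]; exact (le_max_left _ _).trans hx
      have d2 : |x.2 - x₀.2| ≤ k⁻¹ := by
        rw [← Real.dist_eq]; exact (le_max_right _ _).trans hx
      rw [abs_le] at d1 d2
      have hk1 : 0 < k⁻¹ := by positivity
      simp only [magSq, φ, fderiv_dot, two_mul]
      refine add_le_add (key _ (by simp) _ ?_) (key _ (by simp) _ ?_)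
      · simp only [F0, Prod.fst_add, abs_le]
        constructor <;> linarith
      · simp only [F0, Prod.snd_add, abs_le]
        constructor <;> linarith
    · rw [indicator_of_notMem hx]
      rw [Metric.mem_closedBall, not_le] at hx
      have hk1 : 1 < ‖k • (x - x₀)‖ := by
        rw [hscale]
        calc 1 = k * k⁻¹ := by field_simp
          _ < _ := by gcongr
      have z : k • (x - x₀) ∉ tsupport (η : Plane → ℝ) := by
        rw [η.tsupport_eq, mem_closedBall_zero_iff, not_le]
        exact hk1
      have z1 : g x = 0 := by
        simp [g, image_eq_zero_of_notMem_tsupport z]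
      have z2 : ∀ v, fderiv ℝ g x v = 0 := by
        intro v
        rw [hgd, image_eq_zero_of_notMem_tsupport fun h => z (tsupport_fderiv_subset ℝ h)]
        simp
      simp [magSq, z1, z2]
  have hvol : ∀ r : ℝ, 0 ≤ r → volume.real (Metric.closedBall x₀ r) = (2 * r) ^ 2 := by
    intro r hr
    rw [← closedBall_prod_same, Measure.volume_eq_prod, measureReal_prod_prod,
      Real.volume_real_closedBall hr, Real.volume_real_closedBall hr, sq]
  have hfin : ∀ r : ℝ, volume (Metric.closedBall x₀ r) ≠ ⊤ := fun r =>
    measure_closedBall_lt_top.ne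
  have hup : ∫ x in Ω, magSq B F0 (fun y => Complex.exp (-Complex.I * (B * φ y : ℝ)) * g y) x ≤
      8 * (M + 1) ^ 2 := by
    have hi : Integrable ((Metric.closedBall x₀ k⁻¹).indicator fun _ => 2 * (k * (M + 1)) ^ 2) :=
      (integrable_indicator_iff measurableSet_closedBall).2 (integrableOn_const (hfin _))
    calc _ ≤ ∫ x in Ω, (Metric.closedBall x₀ k⁻¹).indicator (fun _ => 2 * (k * (M + 1)) ^ 2) x :=
          integral_mono_of_nonneg (ae_of_all _ fun x => magSq_nonneg _ _ _ x) hi.integrableOn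
            (ae_of_all _ hpt)
      _ ≤ ∫ x, (Metric.closedBall x₀ k⁻¹).indicator (fun _ => 2 * (k * (M + 1)) ^ 2) x :=
          setIntegral_le_integral hi (ae_of_all _ fun x =>
            indicator_nonneg (fun _ _ => by positivity) x)
      _ = 8 * (M + 1) ^ 2 := by
          rw [integral_indicator measurableSet_closedBall, setIntegral_const,
            hvol _ (by positivity), smul_eq_mul]
          field_simp
          norm_num
  have hlow : B⁻¹ ≤ ∫ x in Ω, ‖g x‖ ^ 2 := by
    have hsub : Metric.closedBall x₀ (k⁻¹ / 2) ⊆ Ω :=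
      (Metric.closedBall_subset_ball (by have : 0 < k⁻¹ := by positivity
                                         linarith)).trans hball
    calc B⁻¹ = ∫ x in Metric.closedBall x₀ (k⁻¹ / 2), (1 : ℝ) := by
          rw [setIntegral_const, hvol _ (by positivity), ← hkB, smul_eq_mul]
          field_simp
      _ ≤ ∫ x in Metric.closedBall x₀ (k⁻¹ / 2), ‖g x‖ ^ 2 := by
          refine le_of_eq (setIntegral_congr_fun measurableSet_closedBall fun x hx => ?_)
          have h2 : η (k • (x - x₀)) = 1 := by
            refine η.one_of_mem_closedBall ?_
            rw [Metric.mem_closedBall] at hx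
            rw [mem_closedBall_zero_iff, norm_smul, Real.norm_eq_abs, abs_of_pos hk0,
              ← dist_eq_norm]
            calc k * dist x x₀ ≤ k * (k⁻¹ / 2) := by gcongr
              _ = 1 / 2 := by field_simp
          simp [g, h2]
      _ ≤ ∫ x in Ω, ‖g x‖ ^ 2 :=
          setIntegral_mono_set (integrableOn_norm_sq hb hgC)
            (ae_of_all _ fun x => by positivity) hsub.eventuallyLE
  have hpos : 0 < B⁻¹ := by positivity
  have hN : 0 < ∫ x in Ω, ‖g x‖ ^ 2 := hpos.trans_le hlow
  have h3 : lam1 Ω B * ∫ x in Ω, ‖g x‖ ^ 2 ≤ 8 * (M + 1) ^ 2 := h1.trans hup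
  calc lam1 Ω B ≤ 8 * (M + 1) ^ 2 / ∫ x in Ω, ‖g x‖ ^ 2 := (le_div_iff₀ hN).2 h3
    _ ≤ 8 * (M + 1) ^ 2 / B⁻¹ := by gcongr
    _ = _ := by rw [div_inv_eq_mul]

end SC

/-- Comparison of `λ₁(B·A)` with the constant field eigenvalue:
`λ₁(B·A) ≥ λ₁(B) - C_p B^{3/2} ‖curl A - 1‖_{L^p(Ω)}` for every `p > 2`. -/
theorem lam1_comparison_Lp
    (Ω : Set SC.Plane) (hΩ_open : IsOpen Ω) (hΩ_bdd : Bornology.IsBounded Ω)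
    (hΩ_sc : SimplyConnectedSpace ↥Ω) (P : SC.BoundaryParam Ω) :
    ∃ B₀ > 0, ∀ p : ℝ, 2 < p → ∃ C > 0, ∀ B ≥ B₀,
      ∀ A : SC.Plane → SC.Plane, SC.CNearCl 1 Ω A →
        SC.lam1 Ω B - C * B ^ ((3 : ℝ) / 2) *
            (∫ x in Ω, |SC.curl2 A x - 1| ^ p) ^ (1 / p)
          ≤ SC.lam1A Ω B A := by
  have hne : Ω.Nonempty := nonempty_coe_sort.1 inferInstance
  obtain ⟨B₀, hB₀, C₁, hC₁, hlam⟩ := SC.exists_lam1_le hΩ_open hne hΩ_bdd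
  refine ⟨B₀, hB₀, fun p hp => ?_⟩
  obtain ⟨C, hC, hgauge⟩ := SC.exists_gauge hΩ_open hΩ_bdd P hp
  refine ⟨6 * √C₁ * C, by positivity, fun B hB A hA => ?_⟩
  have hB0 : 0 < B := hB₀.trans_le hB
  set I := ∫ x in Ω, |SC.curl2 A x - 1| ^ p
  have hI : 0 ≤ I := integral_nonneg fun x => by positivity
  have hB32 : B ^ ((3 : ℝ) / 2) = B * √B := by
    rw [Real.sqrt_eq_rpow, ← Real.rpow_one_add' hB0.le (by norm_num)]
    norm_num
  have hε : ∀ ε > 0, SC.lam1 Ω B - 6 * √C₁ * C * B ^ ((3 : ℝ) / 2) * (I + ε) ^ (1 / p) ≤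
      SC.lam1A Ω B A := by
    intro ε hε
    obtain ⟨φ, hφ, hbd⟩ := hgauge A hA ε hε
    refine SC.le_lam1A hΩ_open hne hΩ_bdd fun u hu hu0 => ?_
    have h := SC.sub_le_of_forall_pos (s := √(C₁ * B)) (m := SC.lam1 Ω B)
      (d := 2 * B * (C * (I + ε) ^ (1 / p)))
      (q := (∫ x in Ω, SC.magSq B A u x) / ∫ x in Ω, ‖u x‖ ^ 2)
      (div_nonneg (integral_nonneg fun x => SC.magSq_nonneg B A u x) hu0.le)
      (by positivity) (by rw [Real.sq_sqrt (by positivity)]; exact hlam B hB) (by positivity)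
      (fun t ht => by
        have h2 := SC.lam1_mul_le hΩ_open hΩ_bdd hB0 ht hA hφ hbd hu
        rw [← mul_le_mul_iff_left₀ hu0]
        rwa [add_mul, mul_assoc (1 + t) (_ / _), div_mul_cancel₀ _ hu0.ne'])
    refine le_trans (le_of_eq ?_) h
    rw [hB32, Real.sqrt_mul hC₁.le]
    ring
  have hlim : Tendsto (fun ε : ℝ => SC.lam1 Ω B -
      6 * √C₁ * C * B ^ ((3 : ℝ) / 2) * (I + ε) ^ (1 / p)) (𝓝[>] 0)
      (𝓝 (SC.lam1 Ω B - 6 * √C₁ * C * B ^ ((3 : ℝ) / 2) * I ^ (1 / p))) := by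
    have h1 : ContinuousAt (fun ε : ℝ => SC.lam1 Ω B -
        6 * √C₁ * C * B ^ ((3 : ℝ) / 2) * (I + ε) ^ (1 / p)) 0 :=
      continuousAt_const.sub (continuousAt_const.mul
        ((continuousAt_const.add continuousAt_id).rpow_const (Or.inr (by positivity))))
    simpa using h1.tendsto.mono_left nhdsWithin_le_nhds
  exact le_of_tendsto hlim (eventually_mem_nhdsWithin.mono fun ε h => hε ε h)
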